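/- Let q be a positive integer, let a₁,…,a_r be distinct residues mod q with gcd(a_j,q) = 1 and 1 ≤ r < φ(q), and let P be a set of rational primes such that the symmetric difference P △ ∪_{j=1}^r P_{a_j,q} is finite. Then P(x) − (r/φ(q))·π(x) = Ω(x^{1/2}/log x), with the implied constant depending on P and q. -/

import Mathlib

/-- The set of rational primes congruent to `a` mod `q`. -/
def residueClassPrimes (q : ℕ) (a : ZMod q) : Set ℕ :=
  {p | p.Prime ∧ (p : ZMod q) = a}

/-- The number of elements of a set `P` of natural numbers that are `≤ x`. -/
noncomputable def natCount (P : Set ℕ) (x : ℝ) : ℕ :=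
  Set.ncard {p | p ∈ P ∧ (p : ℝ) ≤ x}

/-- The prime counting function `π(x)`. -/
noncomputable def primePi (x : ℝ) : ℕ := natCount {p | p.Prime} x

/-- `f = Ω(g)`: `limsup |f|/g > 0`, i.e. there are `c > 0` and arbitrarily large `x`
with `|f x| ≥ c * g x`. -/
def IsOmega (f g : ℝ → ℝ) : Prop :=
  ∃ c > (0:ℝ), ∀ X : ℝ, ∃ x ≥ X, |f x| ≥ c * g x

open Complex Metric Filter Topology Real Set MeasureTheory Asymptotics

theorem Differentiable.analyticOrderAt_ne_top {f : ℂ → ℂ} (hf : Differentiable ℂ f) {w : ℂ}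
    (hw : f w ≠ 0) (z : ℂ) : analyticOrderAt f z ≠ ⊤ := by
  have h : AnalyticOnNhd ℂ f univ := fun x _ ↦ hf.analyticAt x
  refine h.analyticOrderAt_ne_top_of_isPreconnected isPreconnected_univ (mem_univ w)
    (mem_univ z) ?_
  rw [(hf.analyticAt w).analyticOrderAt_eq_zero.mpr hw]
  simp

theorem Differentiable.eventually_nhdsNE_ne_zero {f : ℂ → ℂ} (hf : Differentiable ℂ f) {w : ℂ}
    (hw : f w ≠ 0) (z : ℂ) : ∀ᶠ x in 𝓝[≠] z, f x ≠ 0 := by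
  refine (hf.analyticAt z).eventually_eq_zero_or_eventually_ne_zero.resolve_left fun h ↦ ?_
  exact hf.analyticOrderAt_ne_top hw z (analyticOrderAt_eq_top.mpr h)

/-- Entire functions with the same zeros differ by an entire factor without zeros. -/
theorem Differentiable.exists_eq_mul_of_analyticOrderAt_eq {f g : ℂ → ℂ}
    (hf : Differentiable ℂ f) (hg : Differentiable ℂ g) {w : ℂ} (hw : g w ≠ 0)
    (h : ∀ z, analyticOrderAt f z = analyticOrderAt g z) :
    ∃ u : ℂ → ℂ, Differentiable ℂ u ∧ (∀ z, u z ≠ 0) ∧ ∀ z, f z = u z * g z := by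
  have hm : MeromorphicOn (f / g) univ := fun z _ ↦
    (hf.analyticAt z).meromorphicAt.div (hg.analyticAt z).meromorphicAt
  set u := toMeromorphicNFOn (f / g) univ with hu
  have hNF (z : ℂ) : MeromorphicNFAt u z := meromorphicNFOn_toMeromorphicNFOn _ _ (mem_univ z)
  have hord (z : ℂ) : meromorphicOrderAt u z = 0 := by
    rw [hu, meromorphicOrderAt_toMeromorphicNFOn hm (mem_univ z),
      meromorphicOrderAt_div (hf.analyticAt z).meromorphicAt (hg.analyticAt z).meromorphicAt,
      (hf.analyticAt z).meromorphicOrderAt_eq, (hg.analyticAt z).meromorphicOrderAt_eq, h z]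
    have := hg.analyticOrderAt_ne_top hw z
    lift analyticOrderAt g z to ℕ using this with n
    simp only [ENat.map_natCast]
    exact LinearOrderedAddCommGroupWithTop.sub_self_eq_zero_of_ne_top (by simp)
  have hdiff : Differentiable ℂ u := fun z ↦
    ((hNF z).meromorphicOrderAt_nonneg_iff_analyticAt.mp (hord z).ge).differentiableAt
  refine ⟨u, hdiff, fun z ↦ (hNF z).meromorphicOrderAt_eq_zero_iff.mp (hord z), fun z ↦ ?_⟩
  have hE : f =ᶠ[𝓝[≠] z] fun x ↦ u x * g x := by
    filter_upwards [hm.toMeromorphicNFOn_eq_self_on_nhdsNE (mem_univ z),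
      hg.eventually_nhdsNE_ne_zero hw z] with x hx hgx
    rw [hu, hx, Pi.div_apply, div_mul_cancel₀ _ hgx]
  have h1 : Tendsto f (𝓝[≠] z) (𝓝 (f z)) := (hf z).continuousAt.tendsto.mono_left inf_le_left
  have h2 : Tendsto (fun x ↦ u x * g x) (𝓝[≠] z) (𝓝 (u z * g z)) :=
    ((hdiff z).continuousAt.mul (hg z).continuousAt).tendsto.mono_left inf_le_left
  exact tendsto_nhds_unique h1 (h2.congr' hE.symm)

theorem exists_eq_cexp_of_differentiable {u : ℂ → ℂ} (hu : Differentiable ℂ u) (h0 : ∀ z, u z ≠ 0) :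
    ∃ φ : ℂ → ℂ, Differentiable ℂ φ ∧ ∀ z, u z = cexp (φ z) := by
  have hd : Differentiable ℂ (fun z ↦ deriv u z / u z) :=
    ((hu.contDiff (n := 2)).differentiable_deriv_two).div hu h0
  obtain ⟨φ, hφ0, hφ⟩ := hd.isExactOn_univ.with_val_at 0 (Complex.log (u 0))
  refine ⟨φ, fun z ↦ (hφ z (mem_univ z)).differentiableAt, fun z ↦ ?_⟩
  have hder (x : ℂ) : HasDerivAt (fun z ↦ u z * cexp (-φ z)) 0 x := by
    have h1 := (hu x).hasDerivAt.mul ((hφ x (mem_univ x)).neg.cexp)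
    convert! h1 using 1
    have := h0 x
    field_simp
    ring
  have hc := is_const_of_deriv_eq_zero (f := fun z ↦ u z * cexp (-φ z))
    (fun x ↦ (hder x).differentiableAt) (fun x ↦ (hder x).deriv) z 0
  simp only [hφ0, Complex.exp_neg, Complex.exp_log (h0 0)] at hc
  rw [mul_inv_cancel₀ (h0 0)] at hc
  rw [← div_eq_mul_inv, div_eq_one_iff_eq (Complex.exp_ne_zero _)] at hc
  exact hc

/-- Functions on `ℂ` of growth at most `exp (C (1 + ‖s‖) ^ 2)`. -/
def HasQuadraticGrowth (f : ℂ → ℂ) : Prop :=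
  ∃ C ≥ 0, ∀ s, ‖f s‖ ≤ rexp (C * (1 + ‖s‖) ^ 2)

theorem HasQuadraticGrowth.mul {f g : ℂ → ℂ} (hf : HasQuadraticGrowth f)
    (hg : HasQuadraticGrowth g) : HasQuadraticGrowth (fun s ↦ f s * g s) := by
  obtain ⟨C, hC, h⟩ := hf
  obtain ⟨D, hD, h'⟩ := hg
  refine ⟨C + D, by positivity, fun s ↦ ?_⟩
  rw [norm_mul, add_mul, Real.exp_add]
  exact mul_le_mul (h s) (h' s) (norm_nonneg _) (Real.exp_pos _).le

theorem hasQuadraticGrowth_one : HasQuadraticGrowth (fun _ ↦ 1) :=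
  ⟨0, le_rfl, fun s ↦ by simp⟩

theorem HasQuadraticGrowth.pow {f : ℂ → ℂ} (hf : HasQuadraticGrowth f) (n : ℕ) :
    HasQuadraticGrowth (fun s ↦ f s ^ n) := by
  induction n with
  | zero => simpa using hasQuadraticGrowth_one
  | succ n ih => simpa [pow_succ] using ih.mul hf

theorem HasQuadraticGrowth.prod {ι : Type*} {f : ι → ℂ → ℂ} (t : Finset ι)
    (hf : ∀ i, HasQuadraticGrowth (f i)) : HasQuadraticGrowth (fun s ↦ ∏ i ∈ t, f i s) := by
  classical
  induction t using Finset.induction_on with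
  | empty => simpa using hasQuadraticGrowth_one
  | insert a t ha ih => simpa [Finset.prod_insert ha] using (hf a).mul ih

theorem hasQuadraticGrowth_sub_const (a : ℂ) : HasQuadraticGrowth (fun s ↦ s - a) := by
  refine ⟨1 + ‖a‖, by positivity, fun s ↦ ?_⟩
  have h1 : ‖s - a‖ ≤ ‖s‖ + ‖a‖ := norm_sub_le s a
  have h2 := Real.add_one_le_exp ((1 + ‖a‖) * (1 + ‖s‖) ^ 2)
  nlinarith [norm_nonneg s, norm_nonneg a, mul_nonneg (norm_nonneg s) (norm_nonneg a),
    mul_nonneg (norm_nonneg a) (sq_nonneg ‖s‖)]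

theorem Differentiable.log_norm_le_circleAverage {f : ℂ → ℂ} (hf : Differentiable ℂ f)
    (h0 : f 0 ≠ 0) {R : ℝ} (hR : 0 < R) :
    Real.log ‖f 0‖ ≤ circleAverage (fun z ↦ Real.log ‖f z‖) 0 R := by
  have han : AnalyticOnNhd ℂ f (closedBall 0 |R|) := fun z _ ↦ hf.analyticAt z
  rw [AnalyticOnNhd.circleAverage_log_norm hR.ne' han h0]
  refine le_add_of_nonneg_left (finsum_nonneg fun u ↦ ?_)
  by_cases hu : u ∈ closedBall (0 : ℂ) |R|
  · refine mul_nonneg (by exact_mod_cast MeromorphicOn.AnalyticOnNhd.divisor_nonneg han u) ?_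
    rcases eq_or_ne u 0 with rfl | hu0
    · simp
    · refine Real.log_nonneg ?_
      rw [← div_eq_mul_inv, one_le_div (by simpa using hu0)]
      simpa [abs_of_pos hR] using hu
  · simp [Function.locallyFinsuppWithin.apply_eq_zero_of_notMem _ hu]

theorem re_le_of_mul_cexp {f g φ : ℂ → ℂ}
    (hg : Differentiable ℂ g) (hφ : Differentiable ℂ φ) (h0 : g 0 ≠ 0)
    (h : ∀ s, f s = cexp (φ s) * g s) {R M : ℝ} (hR : 0 < R) (hM : 0 ≤ M)
    (hfM : ∀ z, ‖z‖ = R → ‖f z‖ ≤ rexp M) (hgM : ∀ z, ‖z‖ = R → ‖g z‖ ≤ rexp M)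
    {w : ℂ} (hw : ‖w‖ ≤ R / 2) :
    (φ w).re ≤ 3 * (3 * M - Real.log ‖g 0‖) := by
  have hwR : w ∈ ball (0 : ℂ) R := by rw [mem_ball_zero_iff]; linarith
  have hsph (z : ℂ) (hz : z ∈ sphere (0 : ℂ) |R|) : ‖z‖ = R := by simpa [abs_of_pos hR] using hz
  have hlog {F : ℂ → ℂ} (hF : ∀ z, ‖z‖ = R → ‖F z‖ ≤ rexp M) (z : ℂ) (hz : ‖z‖ = R) :
      Real.log ‖F z‖ ≤ M := by
    rcases eq_or_ne (F z) 0 with h | h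
    · simpa [h] using hM
    · rw [Real.log_le_iff_le_exp (by simpa using h)]
      exact hF z hz
  have hli {F : ℂ → ℂ} (hF : Differentiable ℂ F) :
      CircleIntegrable (fun z ↦ Real.log ‖F z‖) 0 R :=
    MeromorphicOn.circleIntegrable_log_norm fun z _ ↦ (hF.analyticAt z).meromorphicAt
  have hcd : (fun z ↦ poissonKernel 0 w z * (φ z).re) =ᶠ[codiscreteWithin (sphere 0 |R|)]
      fun z ↦ poissonKernel 0 w z * (Real.log ‖f z‖ - Real.log ‖g z‖) := by
    refine mem_codiscreteWithin_iff_forall_mem_nhdsNE.mpr fun z _ ↦ ?_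
    filter_upwards [hg.eventually_nhdsNE_ne_zero h0 z] with x hx
    left
    simp [h x, Real.log_mul (Real.exp_ne_zero _) (norm_ne_zero_iff.mpr hx), Complex.norm_exp]
  have hcont : ContinuousOn (poissonKernel 0 w) (sphere (0 : ℂ) |R|) := by
    rw [poissonKernel_eq_re_herglotzRieszKernel]
    exact Complex.continuous_re.comp_continuousOn (continuousOn_herglotzRieszKernel_sphere hwR)
  have hci : CircleIntegrable (fun z ↦ poissonKernel 0 w z * (φ z).re) 0 R :=
    ContinuousOn.circleIntegrable' (hcont.mul
      (Complex.continuous_re.comp hφ.continuous).continuousOn)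
  have hP : (φ w).re = circleAverage (fun z ↦ poissonKernel 0 w z * (φ z).re) 0 R := by
    have h1 := (hφ.diffContOnCl (s := ball 0 R)).circleAverage_poissonKernel_smul hwR
    rw [← h1]
    have h2 : CircleIntegrable (poissonKernel 0 w • φ) 0 R := by
      refine ContinuousOn.circleIntegrable' ?_
      exact ContinuousOn.smul hcont hφ.continuous.continuousOn
    have h3 := Complex.reCLM.circleAverage_comp_comm h2
    rw [Complex.reCLM_apply] at h3
    rw [← h3]
    congr 1
    ext z
    simp
  rw [hP, circleAverage_congr_codiscreteWithin hcd hR.ne']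
  have hi2 := hci.congr_codiscreteWithin hcd
  have hmajor : CircleIntegrable (fun z ↦ (3 : ℝ) * (3 * M - Real.log ‖g z‖)) 0 R :=
    ((circleIntegrable_const (3 * M) 0 R).sub (hli hg)).const_fun_smul (a := (3 : ℝ))
  refine (circleAverage_mono hi2 hmajor fun z hz ↦ ?_).trans ?_
  · have hz' := hsph z hz
    have hzs : z ∈ sphere (0 : ℂ) R := by simpa using hz'
    have hk : poissonKernel 0 w z ≤ 3 := by
      rw [poissonKernel_eq_re_herglotzRieszKernel]
      refine (re_herglotzRieszKernel_le hzs hwR).trans ?_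
      rw [sub_zero, div_le_iff₀ (by linarith)]
      linarith
    have hk0 : 0 ≤ poissonKernel 0 w z := by
      rw [poissonKernel_eq_re_herglotzRieszKernel]
      refine le_trans ?_ (le_re_herglotzRieszKernel hzs hwR)
      rw [sub_zero]
      exact div_nonneg (by linarith) (by positivity)
    have h1 := hlog hfM z hz'
    have h2 := hlog hgM z hz'
    calc poissonKernel 0 w z * (Real.log ‖f z‖ - Real.log ‖g z‖)
        ≤ poissonKernel 0 w z * (3 * M - Real.log ‖g z‖) :=
          mul_le_mul_of_nonneg_left (by linarith) hk0
      _ ≤ 3 * (3 * M - Real.log ‖g z‖) := mul_le_mul_of_nonneg_right hk (by linarith)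
  · have e : circleAverage (fun z ↦ (3 : ℝ) * (3 * M - Real.log ‖g z‖)) 0 R =
        3 * (3 * M - circleAverage (fun z ↦ Real.log ‖g z‖) 0 R) := by
      have h1 := circleAverage_fun_sub (circleIntegrable_const (3 * M) 0 R) (hli hg)
      rw [circleAverage_const] at h1
      have h2 := circleAverage_fun_smul (a := (3 : ℝ)) (c := (0 : ℂ)) (R := R)
        (f := fun z ↦ 3 * M - Real.log ‖g z‖)
      simp only [smul_eq_mul] at h2
      rw [h2, h1]
    rw [e]
    have := hg.log_norm_le_circleAverage h0 hR
    linarith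

/-- An entire function whose real part grows at most quadratically is a polynomial. -/
theorem exists_polynomial_of_re_le {φ : ℂ → ℂ} (hφ : Differentiable ℂ φ) {A : ℝ}
    (h : ∀ R ≥ 1, ∀ w, ‖w‖ ≤ R / 2 → (φ w).re ≤ A * R ^ 2) :
    ∃ P : Polynomial ℂ, ∀ s, φ s = P.eval s := by
  set B : ℝ := |A| + 1 with hB
  have hbound (R : ℝ) (hR : 1 ≤ R) (n : ℕ) :
      ‖iteratedDeriv n φ 0‖ ≤ n.factorial * (2 * (B * R ^ 2) + 3 * ‖φ 0‖) / (R / 4) ^ n := by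
    refine norm_iteratedDeriv_le_of_forall_mem_sphere_norm_le n (by positivity)
      hφ.diffContOnCl fun z hz ↦ ?_
    have hz' : ‖z‖ = R / 4 := by simpa using hz
    have hM : 0 < B * R ^ 2 := by positivity
    have hmaps : MapsTo φ (ball 0 (R / 2)) {z | z.re ≤ B * R ^ 2} := fun w hw ↦ by
      have h1 := h R hR w (by simpa using (mem_ball_zero_iff.mp hw).le)
      have h2 : A ≤ B := by rw [hB]; linarith [le_abs_self A]
      exact h1.trans (mul_le_mul_of_nonneg_right h2 (by positivity))
    have h3 := borelCaratheodory hM hφ.differentiableOn hmaps (by positivity)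
      (z := z) (by rw [mem_ball_zero_iff, hz']; linarith)
    refine h3.trans (le_of_eq ?_)
    rw [hz']
    have : R ≠ 0 := by positivity
    field_simp
    ring
  have hzero (n : ℕ) (hn : 3 ≤ n) : iteratedDeriv n φ 0 = 0 := by
    have h1 (R : ℝ) (hR : 1 ≤ R) : ‖iteratedDeriv n φ 0‖ ≤
        (n.factorial * (2 * B + 3 * ‖φ 0‖) * 4 ^ n) * R⁻¹ := by
      refine (hbound R hR n).trans ?_
      have h2 : 2 * (B * R ^ 2) + 3 * ‖φ 0‖ ≤ (2 * B + 3 * ‖φ 0‖) * R ^ 2 := by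
        nlinarith [norm_nonneg (φ 0), mul_nonneg (norm_nonneg (φ 0))
          (show (0 : ℝ) ≤ R ^ 2 - 1 by nlinarith)]
      have h3 : R ^ 3 ≤ R ^ n := pow_le_pow_right₀ hR hn
      have hRpos : 0 < R := by positivity
      rw [div_pow, ← div_eq_mul_inv, div_div_eq_mul_div, div_le_div_iff₀ (by positivity) hRpos]
      calc n.factorial * (2 * (B * R ^ 2) + 3 * ‖φ 0‖) * 4 ^ n * R
          ≤ n.factorial * ((2 * B + 3 * ‖φ 0‖) * R ^ 2) * 4 ^ n * R := by gcongr
        _ = n.factorial * (2 * B + 3 * ‖φ 0‖) * 4 ^ n * R ^ 3 := by ring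
        _ ≤ _ := by gcongr
    have h4 : Tendsto (fun R : ℝ ↦ (n.factorial * (2 * B + 3 * ‖φ 0‖) * 4 ^ n) * R⁻¹) atTop
        (𝓝 0) := by
      simpa using tendsto_inv_atTop_zero.const_mul (n.factorial * (2 * B + 3 * ‖φ 0‖) * 4 ^ n)
    have h5 : ‖iteratedDeriv n φ 0‖ ≤ 0 :=
      ge_of_tendsto h4 ((eventually_ge_atTop 1).mono h1)
    simpa using h5
  refine ⟨∑ n ∈ Finset.range 3, Polynomial.C ((n.factorial : ℂ)⁻¹ * iteratedDeriv n φ 0) *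
    Polynomial.X ^ n, fun s ↦ ?_⟩
  rw [← taylorSeries_eq_of_entire' (c := 0) s hφ, tsum_eq_sum (s := Finset.range 3)]
  · simp [Polynomial.eval_finsetSum]
  · intro n hn
    simp [hzero n (by simpa using hn)]

/-- A weak form of Hadamard's factorization theorem for functions of order at most two. -/
theorem exists_polynomial_eq_mul_cexp {f g : ℂ → ℂ} (hf : Differentiable ℂ f)
    (hg : Differentiable ℂ g) (hfo : HasQuadraticGrowth f) (hgo : HasQuadraticGrowth g)
    (h0 : g 0 ≠ 0) (h : ∀ z, analyticOrderAt f z = analyticOrderAt g z) :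
    ∃ P : Polynomial ℂ, ∀ s, f s = g s * cexp (P.eval s) := by
  obtain ⟨u, hu, hu0, huf⟩ := hf.exists_eq_mul_of_analyticOrderAt_eq hg h0 h
  obtain ⟨φ, hφ, hφu⟩ := exists_eq_cexp_of_differentiable hu hu0
  obtain ⟨C, hC, hfC⟩ := hfo
  obtain ⟨D, hD, hgD⟩ := hgo
  have key : ∀ R ≥ 1, ∀ w, ‖w‖ ≤ R / 2 →
      (φ w).re ≤ (36 * (C + D) + 3 * |Real.log ‖g 0‖|) * R ^ 2 := by
    intro R hR w hw
    have h1 := re_le_of_mul_cexp hg hφ h0 (fun s ↦ by rw [huf, hφu]) (R := R)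
      (M := (C + D) * (1 + R) ^ 2) (by linarith) (by positivity)
      (fun z hz ↦ (hfC z).trans ?_) (fun z hz ↦ (hgD z).trans ?_) hw
    · refine h1.trans ?_
      have h2 : (1 + R) ^ 2 ≤ 4 * R ^ 2 := by nlinarith
      have h3 : -Real.log ‖g 0‖ ≤ |Real.log ‖g 0‖| := neg_le_abs _
      have h4 : |Real.log ‖g 0‖| ≤ |Real.log ‖g 0‖| * R ^ 2 :=
        le_mul_of_one_le_right (abs_nonneg _) (by nlinarith)
      have h5 : (C + D) * (1 + R) ^ 2 ≤ (C + D) * (4 * R ^ 2) := by gcongr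
      linarith
    · rw [hz]; gcongr; linarith
    · rw [hz]; gcongr; linarith
  obtain ⟨P, hP⟩ := exists_polynomial_of_re_le hφ key
  exact ⟨P, fun s ↦ by rw [huf, hφu, hP, mul_comm]⟩

theorem AnalyticAt.tendsto_sub_mul_logDeriv {f : ℂ → ℂ} {ρ : ℂ} (hf : AnalyticAt ℂ f ρ)
    (h : analyticOrderAt f ρ ≠ ⊤) :
    Tendsto (fun s ↦ (s - ρ) * logDeriv f s) (𝓝[≠] ρ) (𝓝 (analyticOrderNatAt f ρ)) := by
  obtain ⟨g, hg, hg0, hfg⟩ := hf.analyticOrderAt_ne_top.mp h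
  set m := analyticOrderNatAt f ρ
  have hlim : Tendsto (fun s ↦ (m : ℂ) + (s - ρ) * logDeriv g s) (𝓝[≠] ρ) (𝓝 m) := by
    have h1 : ContinuousAt (fun s ↦ (m : ℂ) + (s - ρ) * logDeriv g s) ρ := by
      have : ContinuousAt (logDeriv g) ρ := (hg.deriv.continuousAt).div hg.continuousAt hg0
      fun_prop
    simpa [ContinuousAt] using h1.tendsto.mono_left (nhdsWithin_le_nhds (s := {ρ}ᶜ))
  refine hlim.congr' ?_
  have h2 : f =ᶠ[𝓝[≠] ρ] fun z ↦ (z - ρ) ^ m * g z := by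
    simpa using hfg.filter_mono nhdsWithin_le_nhds
  filter_upwards [logDeriv_congr_nhdsNE h2, self_mem_nhdsWithin,
    (hg.continuousAt.eventually_ne hg0).filter_mono nhdsWithin_le_nhds,
    hg.eventually_analyticAt.filter_mono nhdsWithin_le_nhds] with s hs hsρ hgs hga
  have hne : s - ρ ≠ 0 := sub_ne_zero.mpr hsρ
  rw [hs, logDeriv_mul (f := fun z ↦ (z - ρ) ^ m) s (pow_ne_zero _ hne) hgs (by fun_prop)
    hga.differentiableAt,
    logDeriv_fun_pow (by fun_prop)]
  simp only [logDeriv_apply, deriv_sub_const, deriv_id'']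
  field_simp

/-- The tail `∫_1^∞ F(t) t^{-s-1} dt` of a Mellin transform. -/
noncomputable def tailMellin (F : ℝ → ℂ) (s : ℂ) : ℂ :=
  ∫ t in Ioi (1 : ℝ), F t * (t : ℂ) ^ (-(s + 1))

theorem norm_ofReal_cpow_neg_add_one {t : ℝ} (ht : 1 < t) (s : ℂ) :
    ‖(t : ℂ) ^ (-(s + 1))‖ = t ^ (-(s.re + 1)) := by
  rw [norm_cpow_eq_rpow_re_of_pos (by linarith)]
  simp

theorem integrableOn_rpow_mul_rpow {a σ : ℝ} (h : a < σ) :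
    IntegrableOn (fun t : ℝ ↦ t ^ a * t ^ (-(σ + 1))) (Ioi 1) := by
  refine (integrableOn_Ioi_rpow_of_lt (a := a - σ - 1) (by linarith) one_pos).congr_fun
    (fun t ht ↦ ?_) measurableSet_Ioi
  have ht : (1 : ℝ) < t := ht
  dsimp only
  rw [← Real.rpow_add (by linarith)]
  ring_nf

theorem integral_rpow_mul_rpow {a σ : ℝ} (h : a < σ) :
    ∫ t in Ioi (1 : ℝ), t ^ a * t ^ (-(σ + 1)) = 1 / (σ - a) := by
  have : ∫ t in Ioi (1 : ℝ), t ^ a * t ^ (-(σ + 1)) = ∫ t in Ioi (1 : ℝ), t ^ (a - σ - 1) := by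
    refine setIntegral_congr_fun measurableSet_Ioi fun t ht ↦ ?_
    have ht : (1 : ℝ) < t := ht
    rw [← Real.rpow_add (by linarith)]
    ring_nf
  rw [this, integral_Ioi_rpow_of_lt (by linarith) one_pos, Real.one_rpow,
    div_eq_div_iff (by linarith) (by linarith)]
  ring

theorem norm_tailMellin_le {F : ℝ → ℂ} {K a L b : ℝ} {s : ℂ}
    (hF : ∀ t, 1 < t → ‖F t‖ ≤ K * t ^ a + L * t ^ b) (ha : a < s.re) (hb : b < s.re) :
    ‖tailMellin F s‖ ≤ K / (s.re - a) + L / (s.re - b) := by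
  have hi : IntegrableOn (fun t : ℝ ↦ K * (t ^ a * t ^ (-(s.re + 1))) +
      L * (t ^ b * t ^ (-(s.re + 1)))) (Ioi 1) :=
    ((integrableOn_rpow_mul_rpow ha).const_mul K).add ((integrableOn_rpow_mul_rpow hb).const_mul L)
  refine (norm_integral_le_of_norm_le hi ?_).trans (le_of_eq ?_)
  · refine (ae_restrict_iff' measurableSet_Ioi).mpr (Eventually.of_forall fun t ht ↦ ?_)
    have ht : (1 : ℝ) < t := ht
    rw [norm_mul, norm_ofReal_cpow_neg_add_one ht]
    have : 0 ≤ t ^ (-(s.re + 1)) := Real.rpow_nonneg (by linarith) _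
    nlinarith [mul_le_mul_of_nonneg_right (hF t ht) this]
  · rw [integral_add ((integrableOn_rpow_mul_rpow ha).const_mul K)
      ((integrableOn_rpow_mul_rpow hb).const_mul L), integral_const_mul, integral_const_mul,
      integral_rpow_mul_rpow ha, integral_rpow_mul_rpow hb]
    ring

theorem tailMellin_eq_mellin (F : ℝ → ℂ) (s : ℂ) :
    tailMellin F s = mellin ((Ioi 1).indicator F) (-s) := by
  rw [tailMellin, mellin]
  have h : ∀ t : ℝ, (t : ℂ) ^ (-s - 1) • (Ioi (1 : ℝ)).indicator F t =
      (Ioi (1 : ℝ)).indicator (fun t : ℝ ↦ F t * (t : ℂ) ^ (-(s + 1))) t := by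
    intro t
    by_cases ht : t ∈ Ioi (1 : ℝ)
    · simp only [indicator_of_mem ht, smul_eq_mul]
      rw [mul_comm, neg_add, sub_eq_add_neg]
    · simp [indicator_of_notMem ht]
  simp_rw [h]
  rw [setIntegral_indicator measurableSet_Ioi]
  congr 2
  ext t
  simp only [mem_Ioi, mem_inter_iff]
  constructor
  · intro h; exact ⟨by linarith, h⟩
  · exact And.right

theorem hasDerivAt_tailMellin {F : ℝ → ℂ} {K a : ℝ} (hm : Measurable F)
    (hF : ∀ t, 1 < t → ‖F t‖ ≤ K * t ^ a) {s : ℂ} (hs : a < s.re) :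
    HasDerivAt (tailMellin F) (-tailMellin (fun t ↦ F t * (Real.log t : ℂ)) s) s := by
  set G : ℝ → ℂ := (Ioi 1).indicator F with hG
  have hGm : Measurable G := hm.indicator measurableSet_Ioi
  have hloc : LocallyIntegrableOn G (Ioi 0) := by
    refine LocallyIntegrable.locallyIntegrableOn (fun x ↦ ?_) _
    refine ⟨Metric.ball x 1, Metric.ball_mem_nhds x one_pos, ?_⟩
    refine Measure.integrableOn_of_bounded (M := |K| * (|x| + 1) ^ |a|)
      (measure_ball_lt_top.ne) hGm.aestronglyMeasurable ?_
    refine (ae_restrict_iff' measurableSet_ball).mpr (Eventually.of_forall fun t ht ↦ ?_)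
    by_cases h1 : t ∈ Ioi (1 : ℝ)
    · rw [hG, indicator_of_mem h1]
      have h1 : 1 < t := h1
      have ht' : t ≤ |x| + 1 := by
        rw [Metric.mem_ball, Real.dist_eq, abs_lt] at ht
        linarith [le_abs_self x]
      calc ‖F t‖ ≤ K * t ^ a := hF t h1
        _ ≤ |K| * t ^ |a| := mul_le_mul (le_abs_self K)
            (Real.rpow_le_rpow_of_exponent_le h1.le (le_abs_self a)) (by positivity) (abs_nonneg _)
        _ ≤ _ := by gcongr
    · rw [hG, indicator_of_notMem h1, norm_zero]
      positivity
  have htop : G =O[atTop] (· ^ (-(-a)) : ℝ → ℝ) := by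
    refine IsBigO.of_bound |K| ?_
    filter_upwards [eventually_gt_atTop 1] with t ht
    rw [hG, indicator_of_mem (mem_Ioi.mpr ht), neg_neg, Real.norm_eq_abs,
      abs_of_nonneg (Real.rpow_nonneg (by linarith) a)]
    exact (hF t ht).trans (mul_le_mul_of_nonneg_right (le_abs_self K)
      (Real.rpow_nonneg (by linarith) a))
  have hbot : G =O[𝓝[>] 0] (· ^ (-((-s).re - 1)) : ℝ → ℝ) := by
    refine IsBigO.of_bound 0 ?_
    filter_upwards [Ioo_mem_nhdsGT (zero_lt_one (α := ℝ))] with t ht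
    rw [hG, indicator_of_notMem (by simpa using ht.2.le)]
    simp
  have h := (mellin_hasDerivAt_of_isBigO_rpow hloc htop (s := -s) (by simpa using hs) hbot
    (by linarith)).2
  have h2 : HasDerivAt (fun z ↦ mellin G (-z)) (-mellin (fun t ↦ Real.log t • G t) (-s)) s := by
    have := h.scomp s (hasDerivAt_neg s)
    rwa [neg_one_smul] at this
  have h3 : tailMellin F = fun z ↦ mellin G (-z) := funext fun z ↦ tailMellin_eq_mellin F z
  rw [h3, tailMellin_eq_mellin]
  convert! h2 using 3
  ext t
  by_cases h1 : t ∈ Ioi (1 : ℝ)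
  · simp only [hG, indicator_of_mem h1, Complex.real_smul]
    ring
  · simp [hG, indicator_of_notMem h1]

theorem differentiableOn_tailMellin {F : ℝ → ℂ} {K a : ℝ} (hm : Measurable F)
    (hF : ∀ t, 1 < t → ‖F t‖ ≤ K * t ^ a) :
    DifferentiableOn ℂ (tailMellin F) {s | a < s.re} :=
  fun _ hs ↦ (hasDerivAt_tailMellin hm hF hs).differentiableAt.differentiableWithinAt

theorem tendsto_mul_tailMellin {F : ℝ → ℂ} {K : ℝ} (hF : ∀ t, 1 < t → ‖F t‖ ≤ K * √t)
    (hlim : Tendsto (fun t ↦ ‖F t‖ / √t) atTop (𝓝 0)) {ρ : ℂ} (hρ : 1 / 2 ≤ ρ.re) :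
    Tendsto (fun ε : ℝ ↦ (ε : ℂ) * tailMellin F (ρ + ε)) (𝓝[>] 0) (𝓝 0) := by
  rw [NormedAddGroup.tendsto_nhds_zero]
  intro δ hδ
  obtain ⟨T, hT⟩ := eventually_atTop.mp (hlim.eventually_lt_const (half_pos hδ))
  set L : ℝ := |K| * |T| with hL
  have hbound (t : ℝ) (ht : 1 < t) : ‖F t‖ ≤ δ / 2 * t ^ (1 / 2 : ℝ) + L * t ^ (-1 / 2 : ℝ) := by
    have htp : 0 < t := by linarith
    have hst : 0 < √t := Real.sqrt_pos.mpr htp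
    have hL0 : 0 ≤ L * t ^ (-1 / 2 : ℝ) := by positivity
    rw [← Real.sqrt_eq_rpow]
    rcases le_total T t with h | h
    · have := hT t h
      rw [div_lt_iff₀ hst] at this
      linarith
    · have e : t ^ (-1 / 2 : ℝ) = √t / t := by
        rw [Real.sqrt_eq_rpow, eq_div_iff htp.ne', ← Real.rpow_add_one htp.ne']
        norm_num
      have h1 : |K| * √t ≤ L * t ^ (-1 / 2 : ℝ) := by
        rw [e, hL, mul_assoc]
        refine mul_le_mul_of_nonneg_left ?_ (abs_nonneg K)
        rw [← mul_div_assoc, le_div_iff₀ htp, mul_comm]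
        exact mul_le_mul_of_nonneg_right (h.trans (le_abs_self T)) hst.le
      have h2 : K * √t ≤ |K| * √t := mul_le_mul_of_nonneg_right (le_abs_self K) hst.le
      have := hF t ht
      have : 0 ≤ δ / 2 * √t := by positivity
      linarith
  have hL0 : 0 ≤ L := by positivity
  have hev : ∀ᶠ ε : ℝ in 𝓝[>] 0, ε * L < δ / 2 := by
    have : Tendsto (fun ε : ℝ ↦ ε * L) (𝓝[>] 0) (𝓝 0) := by
      have h1 : ContinuousAt (fun ε : ℝ ↦ ε * L) 0 := by fun_prop
      simpa [ContinuousAt] using h1.tendsto.mono_left (nhdsWithin_le_nhds (s := Ioi 0))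
    exact this.eventually_lt_const (half_pos hδ)
  filter_upwards [hev, self_mem_nhdsWithin] with ε hε hε0
  have hε0 : 0 < ε := hε0
  have hre : (ρ + ε).re = ρ.re + ε := by simp
  have h1 := norm_tailMellin_le (s := ρ + ε) hbound (by rw [hre]; linarith)
    (by rw [hre]; linarith)
  rw [hre] at h1
  rw [norm_mul, Complex.norm_real, Real.norm_eq_abs, abs_of_pos hε0]
  have h2 : δ / 2 / (ρ.re + ε - 1 / 2) ≤ δ / 2 / ε := by
    gcongr; linarith
  have h3 : L / (ρ.re + ε - -1 / 2) ≤ L := div_le_self hL0 (by linarith)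
  calc ε * ‖tailMellin F (ρ + ε)‖ ≤ ε * (δ / 2 / ε + L) := by gcongr; linarith
    _ = δ / 2 + ε * L := by field_simp
    _ < δ := by linarith

namespace DirichletCharacter

variable {N : ℕ} [NeZero N]

theorem sum_range_level_eq_zero {χ : DirichletCharacter ℂ N} (hχ : χ ≠ 1) :
    ∑ k ∈ Finset.range N, χ k = 0 := by
  rw [← χ.sum_eq_zero_of_ne_one hχ]
  obtain ⟨n, rfl⟩ := Nat.exists_eq_succ_of_ne_zero (NeZero.ne N)
  rw [Finset.sum_range]
  refine Finset.sum_congr rfl fun i _ ↦ ?_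
  congr 1
  exact Fin.cast_val_eq_self i

theorem norm_sum_range_le {χ : DirichletCharacter ℂ N} (hχ : χ ≠ 1) (n : ℕ) :
    ‖∑ k ∈ Finset.range n, χ k‖ ≤ N := by
  induction n using Nat.strong_induction_on with
  | _ n ih =>
    rcases le_or_gt n N with h | h
    · refine (norm_sum_le _ _).trans ?_
      calc ∑ k ∈ Finset.range n, ‖χ k‖ ≤ ∑ _k ∈ Finset.range n, (1 : ℝ) :=
            Finset.sum_le_sum fun k _ ↦ χ.norm_le_one k
        _ ≤ N := by simpa using h
    · have hN : 0 < N := Nat.pos_of_ne_zero (NeZero.ne N)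
      have h1 := ih (n - N) (by omega)
      obtain ⟨m, rfl⟩ := Nat.exists_eq_add_of_le h.le
      rw [Finset.sum_range_add, sum_range_level_eq_zero hχ, zero_add]
      simpa using h1

/-- The partial sums of a Dirichlet character. -/
noncomputable def partialSum (χ : DirichletCharacter ℂ N) (t : ℝ) : ℂ :=
  ∑ k ∈ Finset.Icc 1 ⌊t⌋₊, χ k

theorem norm_sum_Icc_le {χ : DirichletCharacter ℂ N} (hχ : χ ≠ 1) (n : ℕ) :
    ‖∑ k ∈ Finset.Icc 1 n, χ k‖ ≤ N + 1 := by
  have h : ∑ k ∈ Finset.Icc 1 n, χ k = ∑ k ∈ Finset.range (n + 1), χ k - χ 0 := by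
    rw [Finset.range_eq_Ico, Finset.sum_eq_sum_Ico_succ_bot (by omega)]
    simp only [Nat.cast_zero, zero_add, add_sub_cancel_left]
    rfl
  rw [h]
  exact (norm_sub_le _ _).trans (add_le_add (norm_sum_range_le hχ _) (χ.norm_le_one _))

theorem measurable_comp_floor (g : ℕ → ℂ) : Measurable fun t : ℝ ↦ g ⌊t⌋₊ :=
  (measurable_from_nat (f := g)).comp Nat.measurable_floor

theorem LFunction_eq_mul_tailMellin {χ : DirichletCharacter ℂ N} (hχ : χ ≠ 1) {s : ℂ}
    (hs : 0 < s.re) : LFunction χ s = s * tailMellin χ.partialSum s := by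
  have hb (t : ℝ) (_ : 1 < t) : ‖χ.partialSum t‖ ≤ (N + 1) * t ^ (0 : ℝ) := by
    simpa [partialSum] using norm_sum_Icc_le hχ ⌊t⌋₊
  have hm : Measurable χ.partialSum := measurable_comp_floor fun n ↦ ∑ k ∈ Finset.Icc 1 n, χ k
  have hopen : IsOpen {s : ℂ | 0 < s.re} := isOpen_lt continuous_const continuous_re
  have h1 : AnalyticOnNhd ℂ (LFunction χ) {s | 0 < s.re} := fun z _ ↦
    (differentiable_LFunction hχ).analyticAt z
  have h2 : AnalyticOnNhd ℂ (fun s ↦ s * tailMellin χ.partialSum s) {s | 0 < s.re} :=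
    (differentiableOn_id.mul (differentiableOn_tailMellin hm hb)).analyticOnNhd hopen
  refine h1.eqOn_of_preconnected_of_eventuallyEq h2
    (convex_halfSpace_re_gt 0).isPreconnected (z₀ := 2) (by simp) ?_ hs
  filter_upwards [(isOpen_lt continuous_const continuous_re).mem_nhds
    (show (1 : ℝ) < (2 : ℂ).re by simp)] with z hz
  have hz : 1 < z.re := hz
  rw [LFunction_eq_LSeries χ hz, LSeries_eq_mul_integral _ le_rfl (by linarith)
    (LSeriesSummable_of_one_lt_re χ hz)]
  · rfl
  · refine IsBigO.of_bound (N + 1) (Eventually.of_forall fun n ↦ ?_)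
    simpa using norm_sum_Icc_le hχ n

theorem norm_LFunction_le {χ : DirichletCharacter ℂ N} (hχ : χ ≠ 1) {s : ℂ}
    (hs : 1 / 2 ≤ s.re) : ‖LFunction χ s‖ ≤ 2 * (N + 1) * ‖s‖ := by
  rw [LFunction_eq_mul_tailMellin hχ (by linarith), norm_mul, mul_comm]
  refine mul_le_mul_of_nonneg_right ?_ (norm_nonneg s)
  have hb (t : ℝ) (_ : 1 < t) :
      ‖χ.partialSum t‖ ≤ (N + 1) * t ^ (0 : ℝ) + 0 * t ^ (0 : ℝ) := by
    simpa [partialSum] using norm_sum_Icc_le hχ ⌊t⌋₊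
  refine (norm_tailMellin_le hb (by linarith) (by linarith)).trans ?_
  rw [zero_div, add_zero, sub_zero, div_le_iff₀ (by linarith)]
  have : (0 : ℝ) ≤ N := Nat.cast_nonneg N
  nlinarith

end DirichletCharacter

theorem Real.Gamma_le_exp {x : ℝ} (hx : 1 / 4 ≤ x) : Real.Gamma x ≤ 4 * rexp ((x + 2) ^ 2) := by
  have h1 : Real.Gamma (x + 2) = (x + 1) * (x * Real.Gamma x) := by
    rw [← Real.Gamma_add_one (by linarith), ← Real.Gamma_add_one (by linarith)]
    ring_nf
  have hG : 0 < Real.Gamma x := Real.Gamma_pos_of_pos (by linarith)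
  have h2 : Real.Gamma x ≤ 4 * Real.Gamma (x + 2) := by
    rw [h1]
    nlinarith [mul_pos (show 0 < x by linarith) hG]
  have hn : x + 2 ≤ (⌈x⌉₊ + 1 : ℕ) + 1 := by
    push_cast
    linarith [Nat.le_ceil x]
  have h3 : Real.Gamma (x + 2) ≤ ((⌈x⌉₊ + 1).factorial : ℝ) := by
    rw [← Real.Gamma_nat_eq_factorial]
    exact Real.Gamma_strictMonoOn_Ici.monotoneOn (by simp; linarith)
      (by simp only [mem_Ici]; linarith) hn
  have h4 : ((⌈x⌉₊ + 1).factorial : ℝ) ≤ rexp ((x + 2) ^ 2) := by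
    have hm : ((⌈x⌉₊ + 1 : ℕ) : ℝ) ≤ x + 2 := by
      push_cast
      linarith [Nat.ceil_lt_add_one (show 0 ≤ x by linarith)]
    set n := ⌈x⌉₊ + 1
    calc (n.factorial : ℝ) ≤ (n : ℝ) ^ n := by exact_mod_cast Nat.factorial_le_pow n
      _ ≤ rexp n ^ n := by
          gcongr
          linarith [Real.add_one_le_exp (n : ℝ)]
      _ = rexp ((n : ℝ) ^ 2) := by rw [← Real.exp_nat_mul, sq]
      _ ≤ _ := by gcongr
  linarith

theorem Complex.norm_Gamma_le {s : ℂ} (hs : 0 < s.re) : ‖Complex.Gamma s‖ ≤ Real.Gamma s.re := by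
  rw [Complex.Gamma_eq_integral hs, Real.Gamma_eq_integral hs, Complex.GammaIntegral]
  refine norm_integral_le_of_norm_le (Real.GammaIntegral_convergent hs) ?_
  refine (ae_restrict_iff' measurableSet_Ioi).mpr (Eventually.of_forall fun t ht ↦ ?_)
  rw [norm_mul, norm_cpow_eq_rpow_re_of_pos ht, Complex.norm_real, Real.norm_eq_abs,
    Real.abs_exp]
  simp

theorem Complex.norm_Gammaℝ_le {s : ℂ} (hs : 1 / 2 ≤ s.re) :
    ‖Gammaℝ s‖ ≤ 4 * rexp ((s.re / 2 + 2) ^ 2) := by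
  have hre : (s / 2).re = s.re / 2 := by simp
  rw [Gammaℝ_def, norm_mul, ← one_mul (4 * _)]
  refine mul_le_mul ?_ ?_ (norm_nonneg _) zero_le_one
  · rw [norm_cpow_eq_rpow_re_of_pos Real.pi_pos]
    refine Real.rpow_le_one_of_one_le_of_nonpos (by linarith [Real.pi_gt_three]) ?_
    simp
    linarith
  · refine (norm_Gamma_le (by rw [hre]; linarith)).trans ?_
    rw [hre]
    exact Real.Gamma_le_exp (by linarith)

namespace DirichletCharacter

variable {N : ℕ} [NeZero N]

theorem gammaFactor_ne_zero {N : ℕ} (χ : DirichletCharacter ℂ N) {s : ℂ} (hs : 0 < s.re) :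
    gammaFactor χ s ≠ 0 := by
  rcases χ.even_or_odd with hχ | hχ
  · rw [hχ.gammaFactor_def]
    exact Gammaℝ_ne_zero_of_re_pos hs
  · rw [hχ.gammaFactor_def]
    exact Gammaℝ_ne_zero_of_re_pos (by simp; linarith)

theorem norm_gammaFactor_le {N : ℕ} (χ : DirichletCharacter ℂ N) {s : ℂ} (hs : 1 / 2 ≤ s.re) :
    ‖gammaFactor χ s‖ ≤ 4 * rexp (9 * (1 + ‖s‖) ^ 2) := by
  have h1 := re_le_norm s
  have h2 := norm_nonneg s
  rcases χ.even_or_odd with hχ | hχ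
  · rw [hχ.gammaFactor_def]
    refine (norm_Gammaℝ_le hs).trans ?_
    gcongr
    nlinarith
  · rw [hχ.gammaFactor_def]
    have h3 : (s + 1).re = s.re + 1 := by simp
    refine (norm_Gammaℝ_le (by rw [h3]; linarith)).trans ?_
    rw [h3]
    gcongr
    nlinarith

theorem completedLFunction_eq_mul_gammaFactor {χ : DirichletCharacter ℂ N} (hχ : χ ≠ 1) {s : ℂ}
    (hs : 0 < s.re) : completedLFunction χ s = LFunction χ s * gammaFactor χ s := by
  rw [LFunction_eq_completed_div_gammaFactor χ s (Or.inr fun h ↦ hχ (level_one' χ h)),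
    div_mul_cancel₀ _ (gammaFactor_ne_zero χ hs)]

theorem norm_completedLFunction_le {χ : DirichletCharacter ℂ N} (hχ : χ ≠ 1) {s : ℂ}
    (hs : 1 / 2 ≤ s.re) :
    ‖completedLFunction χ s‖ ≤ rexp ((8 * (N + 1) + 9) * (1 + ‖s‖) ^ 2) := by
  rw [completedLFunction_eq_mul_gammaFactor hχ (by linarith), norm_mul]
  have h1 : 8 * (N + 1) * ‖s‖ ≤ rexp (8 * (N + 1) * (1 + ‖s‖) ^ 2) := by
    have h2 := Real.add_one_le_exp (8 * ((N : ℝ) + 1) * (1 + ‖s‖) ^ 2)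
    have h3 : 8 * ((N : ℝ) + 1) * ‖s‖ ≤ 8 * ((N : ℝ) + 1) * (1 + ‖s‖) ^ 2 := by
      gcongr
      nlinarith [norm_nonneg s]
    linarith
  calc ‖LFunction χ s‖ * ‖gammaFactor χ s‖
      ≤ (2 * (N + 1) * ‖s‖) * (4 * rexp (9 * (1 + ‖s‖) ^ 2)) :=
        mul_le_mul (norm_LFunction_le hχ hs) (norm_gammaFactor_le χ hs) (norm_nonneg _)
          (by positivity)
    _ = 8 * (N + 1) * ‖s‖ * rexp (9 * (1 + ‖s‖) ^ 2) := by ring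
    _ ≤ rexp (8 * (N + 1) * (1 + ‖s‖) ^ 2) * rexp (9 * (1 + ‖s‖) ^ 2) := by gcongr
    _ = _ := by rw [← Real.exp_add]; ring_nf

theorem hasQuadraticGrowth_completedLFunction {χ : DirichletCharacter ℂ N}
    (hχ : χ.IsPrimitive) (h1 : χ ≠ 1) : HasQuadraticGrowth (completedLFunction χ) := by
  set C : ℝ := 8 * (N + 1) + 9 with hC
  have hC0 : 0 ≤ C := by positivity
  set D : ℝ := N + ‖rootNumber χ‖ + 4 * C with hD
  refine ⟨D, by positivity, fun s ↦ ?_⟩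
  rcases le_or_gt (1 / 2) s.re with hs | hs
  · refine (norm_completedLFunction_le h1 hs).trans ?_
    gcongr
    rw [hD]
    linarith [norm_nonneg (rootNumber χ), (Nat.cast_nonneg N : (0 : ℝ) ≤ N)]
  · have h2 := IsPrimitive.completedLFunction_one_sub hχ (1 - s)
    rw [sub_sub_cancel] at h2
    have hN1 : (1 : ℝ) ≤ N := by exact_mod_cast Nat.one_le_iff_ne_zero.mpr (NeZero.ne N)
    have hx := norm_nonneg s
    have hsq : 1 ≤ (1 + ‖s‖) ^ 2 := by nlinarith
    have h3 : ‖(N : ℂ) ^ (1 - s - 1 / 2)‖ ≤ rexp (N * (1 + ‖s‖) ^ 2) := by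
      rw [← Complex.ofReal_natCast, norm_cpow_eq_rpow_re_of_pos (by linarith)]
      have hre : (1 - s - 1 / 2).re = 1 / 2 - s.re := by simp; ring
      rw [hre, Real.rpow_def_of_pos (by linarith)]
      gcongr
      · exact Real.log_le_self (by linarith)
      · have := (abs_le.mp (abs_re_le_norm s)).1
        nlinarith
    have h4 : ‖rootNumber χ‖ ≤ rexp (‖rootNumber χ‖ * (1 + ‖s‖) ^ 2) := by
      have := Real.add_one_le_exp (‖rootNumber χ‖ * (1 + ‖s‖) ^ 2)
      nlinarith [norm_nonneg (rootNumber χ)]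
    have h5 : ‖completedLFunction χ⁻¹ (1 - s)‖ ≤ rexp (4 * C * (1 + ‖s‖) ^ 2) := by
      refine (norm_completedLFunction_le (inv_ne_one.mpr h1) (by simp; linarith)).trans ?_
      have h6 : ‖1 - s‖ ≤ 1 + ‖s‖ := by simpa using norm_sub_le (1 : ℂ) s
      rw [← hC, Real.exp_le_exp, mul_comm 4 C, mul_assoc]
      refine mul_le_mul_of_nonneg_left ?_ hC0
      nlinarith [norm_nonneg (1 - s)]
    rw [h2, norm_mul, norm_mul]
    calc _ ≤ rexp (N * (1 + ‖s‖) ^ 2) * rexp (‖rootNumber χ‖ * (1 + ‖s‖) ^ 2) *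
          rexp (4 * C * (1 + ‖s‖) ^ 2) := by gcongr
      _ = _ := by rw [← Real.exp_add, ← Real.exp_add, hD]; ring_nf

end DirichletCharacter

open ComplexConjugate in
theorem Complex.Gammaℝ_conj (s : ℂ) : Gammaℝ (conj s) = conj (Gammaℝ s) := by
  rw [Gammaℝ_def, Gammaℝ_def, map_mul, ← Gamma_conj,
    cpow_def_of_ne_zero (by simp [Real.pi_ne_zero]),
    cpow_def_of_ne_zero (by simp [Real.pi_ne_zero]), ← exp_conj, ← ofReal_log Real.pi_pos.le]
  simp [map_div₀, Complex.conj_ofNat]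

open ComplexConjugate in
theorem analyticOrderAt_conj_conj {f : ℂ → ℂ} {w : ℂ} (hf : Differentiable ℂ f)
    (hw : f w ≠ 0) (z : ℂ) :
    analyticOrderAt (fun s ↦ conj (f (conj s))) z = analyticOrderAt f (conj z) := by
  have h := hf.analyticOrderAt_ne_top hw (conj z)
  obtain ⟨n, hn⟩ := ENat.ne_top_iff_exists.1 h
  rw [← hn]
  have hd : Differentiable ℂ (fun s ↦ conj (f (conj s))) := fun s ↦ by
    have := (hf (conj s)).conj_conj
    rwa [conj_conj] at this
  rw [eq_comm, (hf.analyticAt _).analyticOrderAt_eq_natCast] at hn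
  rw [(hd.analyticAt _).analyticOrderAt_eq_natCast]
  obtain ⟨g, hg, hg0, he⟩ := hn
  refine ⟨fun s ↦ conj (g (conj s)), ?_, by simpa using hg0, ?_⟩
  · rw [Complex.analyticAt_iff_eventually_differentiableAt] at hg ⊢
    have hc : Tendsto (fun s : ℂ ↦ conj s) (𝓝 z) (𝓝 (conj z)) := continuous_conj.tendsto z
    filter_upwards [hc.eventually hg] with s hs
    have := hs.conj_conj
    rwa [conj_conj] at this
  · have hc : Tendsto (fun s : ℂ ↦ conj s) (𝓝 z) (𝓝 (conj z)) := continuous_conj.tendsto z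
    filter_upwards [hc.eventually he] with s hs
    simp [hs]

namespace DirichletCharacter

variable {N : ℕ} [NeZero N]

open ComplexConjugate

theorem conj_LFunction (χ : DirichletCharacter ℂ N) {s : ℂ} (hs : 1 < s.re) :
    conj (LFunction χ s) = LFunction χ⁻¹ (conj s) := by
  rw [LFunction_eq_LSeries χ hs, LFunction_eq_LSeries χ⁻¹ (by simpa using hs), LSeries, LSeries,
    Complex.conj_tsum]
  refine tsum_congr fun n ↦ ?_
  rcases eq_or_ne n 0 with rfl | hn
  · simp
  rw [LSeries.term_of_ne_zero hn, LSeries.term_of_ne_zero hn, map_div₀, ← MulChar.star_eq_inv,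
    MulChar.star_apply, cpow_conj _ _ (by rw [natCast_arg]; exact Real.pi_ne_zero.symm)]
  simp

omit [NeZero N] in
theorem conj_gammaFactor (χ : DirichletCharacter ℂ N) (s : ℂ) :
    conj (gammaFactor χ s) = gammaFactor χ⁻¹ (conj s) := by
  rcases χ.even_or_odd with h | h
  · have h' : (χ⁻¹).Even := by
      rw [DirichletCharacter.Even, ← MulChar.star_eq_inv, MulChar.star_apply, h]; simp
    rw [h.gammaFactor_def, h'.gammaFactor_def, Gammaℝ_conj]
  · have h' : (χ⁻¹).Odd := by
      rw [DirichletCharacter.Odd, ← MulChar.star_eq_inv, MulChar.star_apply, h]; simp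
    rw [h.gammaFactor_def, h'.gammaFactor_def, ← Gammaℝ_conj]; simp

theorem completedLFunction_two_ne_zero {χ : DirichletCharacter ℂ N} (h1 : χ ≠ 1) :
    completedLFunction χ 2 ≠ 0 := by
  rw [completedLFunction_eq_mul_gammaFactor h1 (by simp)]
  exact mul_ne_zero (LFunction_ne_zero_of_one_le_re χ (.inl h1) (by simp))
    (gammaFactor_ne_zero χ (by simp))

theorem conj_completedLFunction_conj {χ : DirichletCharacter ℂ N} (h1 : χ ≠ 1) (s : ℂ) :
    conj (completedLFunction χ (conj s)) = completedLFunction χ⁻¹ s := by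
  have h1' : χ⁻¹ ≠ 1 := by simpa using h1
  have hd : Differentiable ℂ (fun s ↦ conj (completedLFunction χ (conj s))) := fun s ↦ by
    have := (differentiable_completedLFunction h1 (conj s)).conj_conj
    rwa [conj_conj] at this
  refine congrFun (AnalyticOnNhd.eq_of_eventuallyEq (z₀ := 2) (fun z _ ↦ hd.analyticAt z)
    (fun z _ ↦ (differentiable_completedLFunction h1').analyticAt z) ?_) s
  have : ∀ᶠ s : ℂ in 𝓝 2, 1 < s.re :=
    continuous_re.continuousAt.eventually (lt_mem_nhds (by simp))
  filter_upwards [this] with s hs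
  rw [completedLFunction_eq_mul_gammaFactor h1 (by simp; linarith),
    completedLFunction_eq_mul_gammaFactor h1' (by linarith), map_mul, conj_LFunction χ (by simpa),
    conj_gammaFactor]
  simp

theorem rootNumber_ne_zero {χ : DirichletCharacter ℂ N} (hχ : χ.IsPrimitive) (h1 : χ ≠ 1) :
    rootNumber χ ≠ 0 := by
  intro h
  have := hχ.completedLFunction_one_sub (-1)
  rw [h] at this
  norm_num at this
  exact completedLFunction_two_ne_zero h1 this

theorem completedLFunction_zero_ne_zero {χ : DirichletCharacter ℂ N} (hχ : χ.IsPrimitive)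
    (h1 : χ ≠ 1) : completedLFunction χ 0 ≠ 0 := by
  have h1' : χ⁻¹ ≠ 1 := by simpa using h1
  have := hχ.completedLFunction_one_sub 1
  rw [sub_self] at this
  rw [this, completedLFunction_eq_mul_gammaFactor h1' (by simp)]
  refine mul_ne_zero (mul_ne_zero ?_ (rootNumber_ne_zero hχ h1)) (mul_ne_zero
    (LFunction_ne_zero_of_one_le_re _ (.inl h1') (by simp)) (gammaFactor_ne_zero _ (by simp)))
  simp [cpow_eq_zero_iff, NeZero.ne N]

theorem analyticOrderAt_completedLFunction_one_sub {χ : DirichletCharacter ℂ N}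
    (hχ : χ.IsPrimitive) (h1 : χ ≠ 1) (s : ℂ) :
    analyticOrderAt (completedLFunction χ) (1 - conj s) =
      analyticOrderAt (completedLFunction χ) s := by
  have hd := differentiable_completedLFunction h1
  have hN : (N : ℂ) ≠ 0 := by simp [NeZero.ne N]
  have h2 : analyticOrderAt (completedLFunction χ ∘ fun z ↦ 1 - z) (conj s) =
      analyticOrderAt (completedLFunction χ) (1 - conj s) :=
    analyticOrderAt_comp_of_deriv_ne_zero (g := fun z : ℂ ↦ 1 - z) (by fun_prop)
      (by simp)
  have h3 : (completedLFunction χ ∘ fun z ↦ 1 - z) =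
      (fun z : ℂ ↦ (N : ℂ) ^ (z - 1 / 2) * rootNumber χ) *
        fun z ↦ conj (completedLFunction χ (conj z)) := by
    ext z
    simp only [Function.comp, Pi.mul_apply, conj_completedLFunction_conj h1,
      hχ.completedLFunction_one_sub]
  have hu : Differentiable ℂ fun z : ℂ ↦ (N : ℂ) ^ (z - 1 / 2) * rootNumber χ := by
    intro z
    exact ((differentiableAt_id.sub_const _).const_cpow (.inl hN)).mul_const _
  have hc : Differentiable ℂ (fun s ↦ conj (completedLFunction χ (conj s))) := fun s ↦ by
    have := (hd (conj s)).conj_conj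
    rwa [conj_conj] at this
  rw [← h2, h3, analyticOrderAt_mul (hu.analyticAt _) (hc.analyticAt _),
    (hu.analyticAt _).analyticOrderAt_eq_zero.2, zero_add,
    analyticOrderAt_conj_conj hd (completedLFunction_two_ne_zero h1), conj_conj]
  exact mul_ne_zero (by simp [cpow_eq_zero_iff, NeZero.ne N]) (rootNumber_ne_zero hχ h1)

end DirichletCharacter

open ArithmeticFunction (vonMangoldt)

/-- The restriction of a sequence to the primes. -/
noncomputable def primePart (u : ℕ → ℂ) (n : ℕ) : ℂ := if n.Prime then u n else 0

/-- The restriction of `u * Λ` to the squares. -/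
noncomputable def squarePart (u : ℕ → ℂ) (n : ℕ) : ℂ :=
  if IsSquare n then u n * vonMangoldt n else 0

/-- The restriction of `u * Λ` to the numbers that are neither primes nor squares. -/
noncomputable def higherPart (u : ℕ → ℂ) (n : ℕ) : ℂ :=
  if n.Prime ∨ IsSquare n then 0 else u n * vonMangoldt n

theorem mul_vonMangoldt_eq_add (u : ℕ → ℂ) :
    (fun n ↦ u n * vonMangoldt n) =
      LSeries.logMul (primePart u) + squarePart u + higherPart u := by
  ext n
  simp only [LSeries.logMul, primePart, squarePart, higherPart, Pi.add_apply]
  by_cases h1 : n.Prime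
  · have h2 : ¬ IsSquare n := h1.prime.not_isSquare
    simp [h1, h2, ArithmeticFunction.vonMangoldt_apply_prime h1, natCast_log, mul_comm]
  · by_cases h2 : IsSquare n <;> simp [h1, h2]

theorem norm_term_higherPart_prime_pow_le {u : ℕ → ℂ} {C : ℝ} (hC : 0 ≤ C) (hu : ∀ n, ‖u n‖ ≤ C)
    {p : ℕ} (hp : p.Prime) (k : ℕ) :
    ‖LSeries.term (higherPart u) (1 / 2 : ℝ) (p ^ (k + 1))‖ ≤
      (p : ℝ) ^ (-(5 / 4) : ℝ) * (8 * C * ((2 : ℝ) ^ (-(1 / 2) : ℝ)) ^ k) := by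
  have hp0 : (0 : ℝ) < p := by exact_mod_cast hp.pos
  have hp1 : (1 : ℝ) ≤ p := by exact_mod_cast hp.one_le
  rw [LSeries.norm_term_eq, if_neg (pow_ne_zero _ hp.ne_zero)]
  have h0 : 0 ≤ (p : ℝ) ^ (-(5 / 4) : ℝ) * (8 * C * ((2 : ℝ) ^ (-(1 / 2) : ℝ)) ^ k) := by positivity
  rcases lt_or_ge k 2 with hk | hk
  · have : (p ^ (k + 1)).Prime ∨ IsSquare (p ^ (k + 1)) := by
      interval_cases k
      · simp [hp]
      · exact .inr ⟨p, by ring⟩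
    simpa [higherPart, this] using h0
  · have h1 : ‖higherPart u (p ^ (k + 1))‖ ≤ C * Real.log p := by
      have hl : 0 ≤ Real.log p := Real.log_nonneg hp1
      rw [higherPart]
      split_ifs
      · simpa using mul_nonneg hC hl
      · rw [ArithmeticFunction.vonMangoldt_apply_pow (by omega),
          ArithmeticFunction.vonMangoldt_apply_prime hp, norm_mul, Complex.norm_real,
          Real.norm_of_nonneg hl]
        exact mul_le_mul_of_nonneg_right (hu _) hl
    have h2 : Real.log p ≤ 4 * (p : ℝ) ^ (1 / 4 : ℝ) := by
      have := Real.log_le_rpow_div hp0.le (ε := 1 / 4) (by norm_num)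
      linarith
    have h3 : (p : ℝ) ^ (-((k : ℝ) - 2) / 2) ≤ 2 * ((2 : ℝ) ^ (-(1 / 2) : ℝ)) ^ k := by
      have hk' : (2 : ℝ) ≤ k := by exact_mod_cast hk
      calc (p : ℝ) ^ (-((k : ℝ) - 2) / 2) ≤ (2 : ℝ) ^ (-((k : ℝ) - 2) / 2) :=
            Real.rpow_le_rpow_of_nonpos (by norm_num) (by exact_mod_cast hp.two_le) (by linarith)
        _ = 2 * ((2 : ℝ) ^ (-(1 / 2) : ℝ)) ^ k := by
            rw [← Real.rpow_natCast, ← Real.rpow_mul (by norm_num)]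
            rw [show -((k : ℝ) - 2) / 2 = 1 + -(1 / 2) * k by ring, Real.rpow_add (by norm_num),
              Real.rpow_one]
    calc ‖higherPart u (p ^ (k + 1))‖ / ((p ^ (k + 1) : ℕ) : ℝ) ^ ((1 / 2 : ℝ) : ℂ).re
        ≤ C * (4 * (p : ℝ) ^ (1 / 4 : ℝ)) / ((p ^ (k + 1) : ℕ) : ℝ) ^ ((1 / 2 : ℝ) : ℂ).re := by
          gcongr
          exact h1.trans (mul_le_mul_of_nonneg_left h2 hC)
      _ = 4 * C * (p : ℝ) ^ (-(5 / 4) : ℝ) * (p : ℝ) ^ (-((k : ℝ) - 2) / 2) := by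
          rw [Complex.ofReal_re, Nat.cast_pow, ← Real.rpow_natCast, ← Real.rpow_mul hp0.le,
            div_eq_mul_inv, ← Real.rpow_neg hp0.le, mul_assoc (4 * C), ← Real.rpow_add hp0,
            mul_assoc, mul_assoc, ← Real.rpow_add hp0]
          rw [← mul_assoc, mul_comm C 4]
          congr 2
          push_cast; ring
      _ ≤ 4 * C * (p : ℝ) ^ (-(5 / 4) : ℝ) * (2 * ((2 : ℝ) ^ (-(1 / 2) : ℝ)) ^ k) := by gcongr
      _ = _ := by ring

theorem lseriesSummable_higherPart {u : ℕ → ℂ} {C : ℝ} (hu : ∀ n, ‖u n‖ ≤ C) :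
    LSeriesSummable (higherPart u) (1 / 2 : ℝ) := by
  have hC : 0 ≤ C := (norm_nonneg _).trans (hu 0)
  have hs : Function.support (LSeries.term (higherPart u) (1 / 2 : ℝ)) ⊆ {n | IsPrimePow n} := by
    intro n hn
    by_contra hpp
    refine hn ?_
    have : higherPart u n = 0 := by
      simp [higherPart, (ArithmeticFunction.vonMangoldt_eq_zero_iff).2 hpp]
    simp [LSeries.term, this]
  rw [LSeriesSummable, ← (Subtype.val_injective (p := IsPrimePow)).summable_iff fun n hn ↦
    of_not_not fun h ↦ hn ⟨⟨n, hs h⟩, rfl⟩]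
  refine (Nat.Primes.prodNatEquiv.summable_iff (f := LSeries.term (higherPart u) (1 / 2 : ℝ) ∘
    ((↑) : {n // IsPrimePow n} → ℕ))).1 ?_
  have h1 : Summable fun p : Nat.Primes ↦ (p : ℝ) ^ (-(5 / 4) : ℝ) :=
    Nat.Primes.summable_rpow.2 (by norm_num)
  have h2 : Summable fun k : ℕ ↦ 8 * C * ((2 : ℝ) ^ (-(1 / 2) : ℝ)) ^ k := by
    refine (summable_geometric_of_lt_one (by positivity) ?_).mul_left _
    exact Real.rpow_lt_one_of_one_lt_of_neg (by norm_num) (by norm_num)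
  refine Summable.of_norm_bounded (h1.mul_of_nonneg h2 (fun p ↦ by positivity)
    fun k ↦ by positivity) ?_
  rintro ⟨p, k⟩
  exact norm_term_higherPart_prime_pow_le hC hu p.2 k

theorem LSeries_squarePart (u : ℕ → ℂ) (s : ℂ) :
    LSeries (squarePart u) s = LSeries (fun m ↦ u (m ^ 2) * vonMangoldt m) (2 * s) := by
  have hi : Function.Injective fun m : ℕ ↦ m ^ 2 := Nat.pow_left_injective two_ne_zero
  rw [LSeries, LSeries, ← hi.tsum_eq]
  · refine tsum_congr fun m ↦ ?_
    rcases eq_or_ne m 0 with rfl | hm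
    · simp
    rw [LSeries.term_of_ne_zero (pow_ne_zero _ hm), LSeries.term_of_ne_zero hm, squarePart,
      if_pos ⟨m, sq m⟩, ArithmeticFunction.vonMangoldt_apply_pow two_ne_zero]
    congr 1
    have := natCast_cpow_natCast_mul m 2 s
    push_cast at this ⊢
    rw [this]
  · intro n hn
    by_contra h
    refine hn ?_
    have : squarePart u n = 0 := by
      rw [squarePart, if_neg]
      rintro ⟨m, rfl⟩
      exact h ⟨m, sq m⟩
    simp [LSeries.term, this]

theorem norm_primePart_le {u : ℕ → ℂ} {C : ℝ} (hu : ∀ n, ‖u n‖ ≤ C) (n : ℕ) :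
    ‖primePart u n‖ ≤ C := by
  rw [primePart]
  split_ifs
  · exact hu n
  · simpa using (norm_nonneg _).trans (hu 0)

/-- The summatory function of `u` over the primes. -/
noncomputable def primeSum (u : ℕ → ℂ) (t : ℝ) : ℂ := ∑ k ∈ Finset.Icc 1 ⌊t⌋₊, primePart u k

theorem measurable_primeSum (u : ℕ → ℂ) : Measurable (primeSum u) :=
  DirichletCharacter.measurable_comp_floor fun n ↦ ∑ k ∈ Finset.Icc 1 n, primePart u k

theorem norm_primeSum_le {u : ℕ → ℂ} {C : ℝ} (hu : ∀ n, ‖u n‖ ≤ C) {t : ℝ} (ht : 0 ≤ t) :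
    ‖primeSum u t‖ ≤ C * t := by
  have hC : 0 ≤ C := (norm_nonneg _).trans (hu 0)
  calc ‖primeSum u t‖ ≤ ∑ k ∈ Finset.Icc 1 ⌊t⌋₊, C :=
        norm_sum_le_of_le _ fun k _ ↦ norm_primePart_le hu k
    _ = C * ⌊t⌋₊ := by simp [mul_comm]
    _ ≤ C * t := by gcongr; exact Nat.floor_le ht

theorem primeSum_eq_zero {u : ℕ → ℂ} {t : ℝ} (ht : t < 2) : primeSum u t = 0 := by
  refine Finset.sum_eq_zero fun k hk ↦ ?_
  rw [Finset.mem_Icc] at hk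
  have : ⌊t⌋₊ < 2 := Nat.floor_lt' (by norm_num) |>.2 (by simpa using ht)
  rw [primePart, if_neg]
  intro hp
  have := hp.two_le
  omega

theorem LSeries_logMul_primePart {u : ℕ → ℂ} {C : ℝ} (hu : ∀ n, ‖u n‖ ≤ C) {s : ℂ}
    (hs : 1 < s.re) :
    LSeries (LSeries.logMul (primePart u)) s =
      s * tailMellin (fun t ↦ primeSum u t * (Real.log t : ℂ)) s - tailMellin (primeSum u) s := by
  have ha : LSeries.abscissaOfAbsConv (primePart u) ≤ 1 :=
    LSeries.abscissaOfAbsConv_le_of_le_const ⟨C, fun n _ ↦ norm_primePart_le hu n⟩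
  have hlt {z : ℂ} (hz : 1 < z.re) : LSeries.abscissaOfAbsConv (primePart u) < z.re :=
    ha.trans_lt (by exact_mod_cast hz)
  have heq : LSeries (primePart u) =ᶠ[𝓝 s] fun z ↦ z * tailMellin (primeSum u) z := by
    filter_upwards [(isOpen_lt continuous_const continuous_re).mem_nhds hs] with z hz
    have hz : 1 < z.re := hz
    rw [LSeries_eq_mul_integral _ zero_le_one hz (LSeriesSummable_of_abscissaOfAbsConv_lt_re
      (hlt hz))]
    · rfl
    · refine IsBigO.of_bound C (Eventually.of_forall fun n ↦ ?_)
      simpa [primeSum] using norm_primeSum_le hu (Nat.cast_nonneg n)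
  have h1 := LSeries_deriv (hlt hs)
  have h2 : HasDerivAt (fun z ↦ z * tailMellin (primeSum u) z)
      (1 * tailMellin (primeSum u) s +
        s * -tailMellin (fun t ↦ primeSum u t * (Real.log t : ℂ)) s) s :=
    (hasDerivAt_id s).mul (hasDerivAt_tailMellin (a := 1) (K := C) (measurable_primeSum u)
      (fun t ht ↦ by simpa using norm_primeSum_le hu (by linarith)) hs)
  rw [heq.deriv_eq, h2.deriv] at h1
  linear_combination h1

theorem LSeries_mul_vonMangoldt_eq {u : ℕ → ℂ} {C : ℝ} (hu : ∀ n, ‖u n‖ ≤ C) {s : ℂ}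
    (hs : 1 < s.re) :
    LSeries (fun n ↦ u n * vonMangoldt n) s =
      s * tailMellin (fun t ↦ primeSum u t * (Real.log t : ℂ)) s - tailMellin (primeSum u) s +
        LSeries (fun m ↦ u (m ^ 2) * vonMangoldt m) (2 * s) + LSeries (higherPart u) s := by
  have ha : LSeries.abscissaOfAbsConv (primePart u) ≤ 1 :=
    LSeries.abscissaOfAbsConv_le_of_le_const ⟨C, fun n _ ↦ norm_primePart_le hu n⟩
  have h1 : LSeriesSummable (LSeries.logMul (primePart u)) s :=
    LSeriesSummable_logMul_of_lt_re (ha.trans_lt (by exact_mod_cast hs))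
  have h3 : LSeriesSummable (higherPart u) s :=
    (lseriesSummable_higherPart hu).of_re_le_re (by rw [ofReal_re]; linarith)
  have h2 : LSeriesSummable (squarePart u) s := by
    have hΛ := (ArithmeticFunction.LSeriesSummable_vonMangoldt hs).norm.mul_left C
    refine Summable.of_norm_bounded hΛ fun n ↦ ?_
    rw [LSeries.norm_term_eq, LSeries.norm_term_eq]
    split_ifs with hn
    · simp
    · rw [mul_div_assoc']
      gcongr
      rw [squarePart]
      split_ifs
      · rw [norm_mul]
        exact mul_le_mul_of_nonneg_right (hu n) (norm_nonneg _)
      · rw [norm_zero]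
        exact mul_nonneg ((norm_nonneg _).trans (hu 0)) (norm_nonneg _)
  rw [mul_vonMangoldt_eq_add, LSeries_add (h1.add h2) h3, LSeries_add h1 h2,
    LSeries_logMul_primePart hu hs, LSeries_squarePart]

namespace DirichletCharacter

theorem LSeries_mul_vonMangoldt {N : ℕ} [NeZero N] (χ : DirichletCharacter ℂ N) {s : ℂ}
    (hs : 1 < s.re) :
    LSeries (fun n ↦ χ n * vonMangoldt n) s = -logDeriv (LFunction χ) s := by
  have h := LSeries_twist_vonMangoldt_eq χ hs
  rw [← deriv_LFunction_eq_deriv_LSeries χ hs, ← LFunction_eq_LSeries χ hs] at h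
  rw [logDeriv_apply, ← neg_div, ← h]
  rfl

theorem analyticAt_logDeriv_LFunction {N : ℕ} [NeZero N] (χ : DirichletCharacter ℂ N) {s : ℂ}
    (hs : 1 ≤ s.re) (h1 : s ≠ 1) : AnalyticAt ℂ (logDeriv (LFunction χ)) s := by
  have h : AnalyticAt ℂ (LFunction χ) s := by
    rw [Complex.analyticAt_iff_eventually_differentiableAt]
    filter_upwards [isOpen_ne.mem_nhds h1] with z hz
    exact differentiableAt_LFunction χ z (.inl hz)
  exact h.deriv.div h (LFunction_ne_zero_of_one_le_re χ (.inr h1) hs)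

end DirichletCharacter

open DirichletCharacter

section

variable {ι : Type*} [Fintype ι] {N : ι → ℕ} [∀ i, NeZero (N i)]

/-- A linear combination of Dirichlet characters, as an arithmetic function. -/
noncomputable def charSum (c : ι → ℂ) (χ : ∀ i, DirichletCharacter ℂ (N i)) (n : ℕ) : ℂ :=
  ∑ i, c i * χ i n

omit [∀ i, NeZero (N i)] in
theorem norm_charSum_le (c : ι → ℂ) (χ : ∀ i, DirichletCharacter ℂ (N i)) (n : ℕ) :
    ‖charSum c χ n‖ ≤ ∑ i, ‖c i‖ :=
  norm_sum_le_of_le _ fun i _ ↦ by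
    rw [norm_mul]
    exact mul_le_of_le_one_right (norm_nonneg _) ((χ i).norm_le_one _)

theorem LSeries_charSum_mul_vonMangoldt (c : ι → ℂ) (χ : ∀ i, DirichletCharacter ℂ (N i)) {s : ℂ}
    (hs : 1 < s.re) :
    LSeries (fun n ↦ charSum c χ n * vonMangoldt n) s =
      -∑ i, c i * logDeriv (LFunction (χ i)) s := by
  have h : (fun n ↦ charSum c χ n * vonMangoldt n) =
      ∑ i, c i • fun n : ℕ ↦ (χ i n * vonMangoldt n : ℂ) := by
    ext n
    simp [charSum, Finset.sum_mul, mul_assoc]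
  have hsum (i : ι) : LSeriesSummable (fun n : ℕ ↦ (χ i n * vonMangoldt n : ℂ)) s :=
    LSeriesSummable_twist_vonMangoldt (χ i) hs
  rw [h, LSeries_sum fun i _ ↦ (hsum i).smul (c i), ← Finset.sum_neg_distrib]
  refine Finset.sum_congr rfl fun i _ ↦ ?_
  rw [LSeries_smul, LSeries_mul_vonMangoldt _ hs]
  simp

/-- The analytic continuation to `1 / 2 < re s` of the Dirichlet series of `charSum c χ * Λ`. -/
noncomputable def charSumContinuation (c : ι → ℂ) (χ : ∀ i, DirichletCharacter ℂ (N i))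
    (s : ℂ) : ℂ :=
  s * tailMellin (fun t ↦ primeSum (charSum c χ) t * (Real.log t : ℂ)) s -
    tailMellin (primeSum (charSum c χ)) s - ∑ i, c i * logDeriv (LFunction (χ i ^ 2)) (2 * s) +
      LSeries (higherPart (charSum c χ)) s

theorem neg_sum_logDeriv_eq_charSumContinuation (c : ι → ℂ) (χ : ∀ i, DirichletCharacter ℂ (N i))
    {s : ℂ} (hs : 1 < s.re) :
    -∑ i, c i * logDeriv (LFunction (χ i)) s = charSumContinuation c χ s := by
  rw [← LSeries_charSum_mul_vonMangoldt c χ hs, LSeries_mul_vonMangoldt_eq (norm_charSum_le c χ) hs,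
    charSumContinuation]
  have h2 : (fun m ↦ charSum c χ (m ^ 2) * (vonMangoldt m : ℂ)) =
      fun m ↦ charSum c (fun i ↦ χ i ^ 2) m * (vonMangoldt m : ℂ) := by
    ext m
    simp [charSum, MulChar.pow_apply' _ two_ne_zero]
  rw [h2, LSeries_charSum_mul_vonMangoldt c _ (by simp; linarith)]
  ring

section

variable {c : ι → ℂ} {χ : ∀ i, DirichletCharacter ℂ (N i)}

omit [∀ i, NeZero (N i)] in
theorem exists_norm_primeSum_mul_log_le
    (hF : Tendsto (fun t : ℝ ↦ ‖primeSum (charSum c χ) t * (Real.log t : ℂ)‖ / √t) atTop (𝓝 0)) :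
    ∃ K, ∀ t, 1 < t → ‖primeSum (charSum c χ) t * (Real.log t : ℂ)‖ ≤ K * √t := by
  obtain ⟨T, hT⟩ := eventually_atTop.1 (hF.eventually (gt_mem_nhds one_pos))
  set C := ∑ i, ‖c i‖ with hC
  have hC0 : 0 ≤ C := Finset.sum_nonneg fun i _ ↦ norm_nonneg _
  refine ⟨1 + C * |T| * |T|, fun t ht ↦ ?_⟩
  have hs1 : 1 ≤ √t := Real.one_le_sqrt.2 ht.le
  rcases le_or_gt T t with h | h
  · have := hT t h
    rw [div_lt_one (by positivity)] at this
    nlinarith [mul_nonneg (mul_nonneg hC0 (abs_nonneg T)) (abs_nonneg T)]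
  · have hTt : t ≤ |T| := h.le.trans (le_abs_self T)
    have hl : 0 ≤ Real.log t := Real.log_nonneg ht.le
    have hl' : Real.log t ≤ |T| := (Real.log_le_self (by linarith)).trans hTt
    have h1 : ‖primeSum (charSum c χ) t‖ ≤ C * |T| :=
      (norm_primeSum_le (norm_charSum_le c χ) (by linarith)).trans (by gcongr)
    rw [norm_mul, Complex.norm_real, Real.norm_of_nonneg hl]
    calc ‖primeSum (charSum c χ) t‖ * Real.log t ≤ C * |T| * |T| := by gcongr
      _ ≤ (1 + C * |T| * |T|) * 1 := by linarith
      _ ≤ _ := by gcongr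

omit [∀ i, NeZero (N i)] in
theorem norm_primeSum_le_mul_log {u : ℕ → ℂ} (t : ℝ) :
    ‖primeSum u t‖ ≤ (Real.log 2)⁻¹ * ‖primeSum u t * (Real.log t : ℂ)‖ := by
  rcases lt_or_ge t 2 with h | h
  · simp [primeSum_eq_zero h]
  · have h2 : 0 < Real.log 2 := Real.log_pos (by norm_num)
    have hl : Real.log 2 ≤ Real.log t := Real.log_le_log (by norm_num) h
    rw [norm_mul, Complex.norm_real, Real.norm_of_nonneg (h2.le.trans hl), ← div_eq_inv_mul,
      le_div_iff₀ h2]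
    gcongr

theorem differentiableOn_charSumContinuation {K : ℝ}
    (hK : ∀ t, 1 < t → ‖primeSum (charSum c χ) t * (Real.log t : ℂ)‖ ≤ K * √t) :
    DifferentiableOn ℂ (charSumContinuation c χ) {s | 1 / 2 < s.re} := by
  have hm := measurable_primeSum (charSum c χ)
  have h1 : DifferentiableOn ℂ (tailMellin fun t ↦ primeSum (charSum c χ) t * (Real.log t : ℂ))
      {s | 1 / 2 < s.re} :=
    differentiableOn_tailMellin (K := K) (hm.mul (by fun_prop)) fun t ht ↦ by
      rw [← Real.sqrt_eq_rpow]; exact hK t ht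
  have h0 : DifferentiableOn ℂ (tailMellin (primeSum (charSum c χ))) {s | 1 / 2 < s.re} :=
    differentiableOn_tailMellin (K := (Real.log 2)⁻¹ * K) hm fun t ht ↦ by
      rw [← Real.sqrt_eq_rpow, mul_assoc]
      exact (norm_primeSum_le_mul_log t).trans (by gcongr; exact hK t ht)
  have h2 (i : ι) : DifferentiableOn ℂ (fun s ↦ logDeriv (LFunction (χ i ^ 2)) (2 * s))
      {s | 1 / 2 < s.re} := fun s hs ↦ by
    have hs : 1 / 2 < s.re := hs
    have h2s : 1 < (2 * s).re := by simp; linarith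
    have := (analyticAt_logDeriv_LFunction (χ i ^ 2) h2s.le
      (by rintro h; rw [h] at h2s; simp at h2s)).differentiableAt
    exact (this.comp s
      (by fun_prop : DifferentiableAt ℂ (fun s : ℂ ↦ 2 * s) s)).differentiableWithinAt
  have h3 : DifferentiableOn ℂ (LSeries (higherPart (charSum c χ))) {s | 1 / 2 < s.re} := by
    refine (LSeries_differentiableOn _).mono fun s hs ↦ ?_
    have := (lseriesSummable_higherPart (norm_charSum_le c χ)).abscissaOfAbsConv_le
    refine this.trans_lt ?_
    rw [ofReal_re]
    exact EReal.coe_lt_coe_iff.2 hs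
  exact (((differentiableOn_id.mul h1).sub h0).sub
    (DifferentiableOn.fun_sum fun i _ ↦ (h2 i).const_mul (c i))).add h3

theorem sum_logDeriv_eq_neg_charSumContinuation (hχ : ∀ i, χ i ≠ 1) {K : ℝ}
    (hK : ∀ t, 1 < t → ‖primeSum (charSum c χ) t * (Real.log t : ℂ)‖ ≤ K * √t) {s : ℂ}
    (hs : 1 / 2 < s.re) (h0 : ∏ i, LFunction (χ i) s ≠ 0) :
    ∑ i, c i * logDeriv (LFunction (χ i)) s = -charSumContinuation c χ s := by
  classical
  have hL (i : ι) : Differentiable ℂ (LFunction (χ i)) := differentiable_LFunction (hχ i)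
  have hL' (i : ι) : Differentiable ℂ (deriv (LFunction (χ i))) := fun z ↦
    ((hL i).analyticAt z).deriv.differentiableAt
  let V : ℂ → ℂ := fun s ↦ ∑ i, c i * (deriv (LFunction (χ i)) s *
    ∏ j ∈ Finset.univ.erase i, LFunction (χ j) s)
  have hV : Differentiable ℂ V := Differentiable.fun_sum fun i _ ↦
    ((hL' i).mul (Differentiable.fun_finsetProd fun j _ ↦ hL j)).const_mul _
  have hW : Differentiable ℂ fun s ↦ ∏ i, LFunction (χ i) s :=
    Differentiable.fun_finsetProd fun j _ ↦ hL j
  have key {z : ℂ} (hz : ∏ i, LFunction (χ i) z ≠ 0) :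
      V z = (∏ i, LFunction (χ i) z) * ∑ i, c i * logDeriv (LFunction (χ i)) z := by
    rw [Finset.mul_sum]
    refine Finset.sum_congr rfl fun i _ ↦ ?_
    have hi := Finset.prod_ne_zero_iff.1 hz i (Finset.mem_univ i)
    rw [← Finset.mul_prod_erase _ _ (Finset.mem_univ i), logDeriv_apply]
    field_simp
  have hopen : IsOpen {s : ℂ | 1 / 2 < s.re} := isOpen_lt continuous_const continuous_re
  have h1 : AnalyticOnNhd ℂ V {s | 1 / 2 < s.re} := fun z _ ↦ hV.analyticAt z
  have h2 : AnalyticOnNhd ℂ (fun s ↦ (∏ i, LFunction (χ i) s) * -charSumContinuation c χ s)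
      {s | 1 / 2 < s.re} :=
    (hW.differentiableOn.mul (differentiableOn_charSumContinuation hK).neg).analyticOnNhd hopen
  have h3 := h1.eqOn_of_preconnected_of_eventuallyEq h2
    (convex_halfSpace_re_gt (1 / 2)).isPreconnected (z₀ := 2) (by norm_num) (by
      filter_upwards [(isOpen_lt continuous_const continuous_re).mem_nhds
        (show (1 : ℝ) < (2 : ℂ).re by simp)] with z hz
      rw [key, ← neg_sum_logDeriv_eq_charSumContinuation c χ hz, neg_neg]
      exact Finset.prod_ne_zero_iff.2 fun i _ ↦
        LFunction_ne_zero_of_one_le_re _ (.inl (hχ i)) (le_of_lt hz)) hs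
  simp only [key h0] at h3
  exact mul_left_cancel₀ h0 h3

theorem tendsto_mul_charSumContinuation
    (hF : Tendsto (fun t : ℝ ↦ ‖primeSum (charSum c χ) t * (Real.log t : ℂ)‖ / √t) atTop (𝓝 0))
    {ρ : ℂ} (hρ : 1 / 2 ≤ ρ.re) (hρ' : ρ ≠ 1 / 2) :
    Tendsto (fun ε : ℝ ↦ (ε : ℂ) * charSumContinuation c χ (ρ + ε)) (𝓝[>] 0) (𝓝 0) := by
  obtain ⟨K, hK⟩ := exists_norm_primeSum_mul_log_le hF
  have hε : Tendsto (fun ε : ℝ ↦ (ε : ℂ)) (𝓝[>] 0) (𝓝 0) :=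
    (continuous_ofReal.tendsto' 0 0 (by simp)).mono_left nhdsWithin_le_nhds
  have hρε : Tendsto (fun ε : ℝ ↦ ρ + (ε : ℂ)) (𝓝[>] 0) (𝓝 ρ) := by
    simpa using hε.const_add ρ
  have h1 := tendsto_mul_tailMellin hK hF hρ
  have h0 : Tendsto (fun ε : ℝ ↦ (ε : ℂ) * tailMellin (primeSum (charSum c χ)) (ρ + ε))
      (𝓝[>] 0) (𝓝 0) := by
    refine tendsto_mul_tailMellin (K := (Real.log 2)⁻¹ * K) (fun t ht ↦ ?_) ?_ hρ
    · rw [mul_assoc]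
      exact (norm_primeSum_le_mul_log t).trans (by gcongr; exact hK t ht)
    · refine squeeze_zero (fun t ↦ by positivity) (fun t ↦ ?_)
        (by simpa only [mul_zero] using hF.const_mul (Real.log 2)⁻¹)
      rw [← mul_div_assoc]
      gcongr
      exact norm_primeSum_le_mul_log t
  have h2 (i : ι) : Tendsto (fun ε : ℝ ↦ (ε : ℂ) *
      logDeriv (LFunction (χ i ^ 2)) (2 * (ρ + ε))) (𝓝[>] 0) (𝓝 0) := by
    have ha : AnalyticAt ℂ (logDeriv (LFunction (χ i ^ 2))) (2 * ρ) :=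
      analyticAt_logDeriv_LFunction _ (by simp; linarith) fun h ↦ hρ' (by
        linear_combination h / 2)
    simpa using hε.mul (ha.continuousAt.tendsto.comp (hρε.const_mul 2))
  have h3 : Tendsto (fun ε : ℝ ↦ (ε : ℂ) * LSeries (higherPart (charSum c χ)) (ρ + ε))
      (𝓝[>] 0) (𝓝 0) := by
    have hsum := (lseriesSummable_higherPart (norm_charSum_le c χ)).norm
    have hb : IsBoundedUnder (· ≤ ·) (𝓝[>] (0 : ℝ))
        (fun ε : ℝ ↦ ‖LSeries (higherPart (charSum c χ)) (ρ + ε)‖) := by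
      refine isBoundedUnder_of_eventually_le
        (a := ∑' n, ‖LSeries.term (higherPart (charSum c χ)) (1 / 2 : ℝ) n‖) ?_
      filter_upwards [self_mem_nhdsWithin] with ε hε
      have hε : 0 < ε := hε
      refine tsum_of_norm_bounded hsum.hasSum fun n ↦ LSeries.norm_term_le_of_re_le_re _ ?_ n
      simp only [ofReal_re, add_re]
      linarith
    exact hε.zero_mul_isBoundedUnder_le hb
  have h4 := (((hρε.mul h1).sub h0).sub (tendsto_finsetSum Finset.univ fun i _ ↦
    (h2 i).const_mul (c i))).add h3
  simp only [mul_zero, sub_zero, Finset.sum_const_zero, add_zero] at h4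
  refine h4.congr fun ε ↦ ?_
  have hs : ∑ i, c i * ((ε : ℂ) * logDeriv (LFunction (χ i ^ 2)) (2 * (ρ + ε))) =
      ε * ∑ i, c i * logDeriv (LFunction (χ i ^ 2)) (2 * (ρ + ε)) := by
    rw [Finset.mul_sum]
    exact Finset.sum_congr rfl fun i _ ↦ by ring
  rw [hs, charSumContinuation]
  ring

theorem sum_mul_analyticOrderNatAt_LFunction_eq_zero (hχ : ∀ i, χ i ≠ 1)
    (hF : Tendsto (fun t : ℝ ↦ ‖primeSum (charSum c χ) t * (Real.log t : ℂ)‖ / √t) atTop (𝓝 0))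
    {ρ : ℂ} (hρ : 1 / 2 ≤ ρ.re) (hρ' : ρ ≠ 1 / 2) :
    ∑ i, c i * analyticOrderNatAt (LFunction (χ i)) ρ = 0 := by
  obtain ⟨K, hK⟩ := exists_norm_primeSum_mul_log_le hF
  have hL (i : ι) : Differentiable ℂ (LFunction (χ i)) := differentiable_LFunction (hχ i)
  have hW : Differentiable ℂ fun s ↦ ∏ i, LFunction (χ i) s :=
    Differentiable.fun_finsetProd fun j _ ↦ hL j
  have hL2 (i : ι) : LFunction (χ i) 2 ≠ 0 :=
    LFunction_ne_zero_of_one_le_re _ (.inl (hχ i)) (by simp)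
  have hρε : Tendsto (fun ε : ℝ ↦ ρ + (ε : ℂ)) (𝓝[>] 0) (𝓝[≠] ρ) := by
    refine tendsto_nhdsWithin_iff.2 ⟨?_, ?_⟩
    · exact ((by fun_prop : Continuous fun ε : ℝ ↦ ρ + (ε : ℂ)).tendsto' 0 ρ (by simp)).mono_left
        nhdsWithin_le_nhds
    · filter_upwards [self_mem_nhdsWithin] with ε hε
      simpa using (ne_of_gt hε)
  have h1 : Tendsto (fun ε : ℝ ↦ (ε : ℂ) * ∑ i, c i * logDeriv (LFunction (χ i)) (ρ + ε))
      (𝓝[>] 0) (𝓝 (∑ i, c i * analyticOrderNatAt (LFunction (χ i)) ρ)) := by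
    have h (i : ι) := (((hL i).analyticAt ρ).tendsto_sub_mul_logDeriv
      ((hL i).analyticOrderAt_ne_top (hL2 i) ρ)).comp hρε
    refine (tendsto_finsetSum Finset.univ fun i _ ↦ (h i).const_mul (c i)).congr fun ε ↦ ?_
    rw [Finset.mul_sum]
    refine Finset.sum_congr rfl fun i _ ↦ ?_
    simp only [Function.comp, add_sub_cancel_left]
    ring
  refine tendsto_nhds_unique h1 ?_
  have h2 := (tendsto_mul_charSumContinuation hF hρ hρ').neg
  rw [neg_zero] at h2
  refine h2.congr' ?_
  filter_upwards [hρε.eventually (hW.eventually_nhdsNE_ne_zero (w := 2)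
    (Finset.prod_ne_zero_iff.2 fun i _ ↦ hL2 i) ρ), self_mem_nhdsWithin] with ε h0 hε
  have hε : 0 < ε := hε
  rw [sum_logDeriv_eq_neg_charSumContinuation hχ hK (by simp; linarith) h0]
  ring

end

end

open ComplexConjugate

namespace DirichletCharacter

variable {N : ℕ}

theorem differentiable_gammaFactor_inv (χ : DirichletCharacter ℂ N) :
    Differentiable ℂ fun s ↦ (gammaFactor χ s)⁻¹ := by
  rcases χ.even_or_odd with h | h
  · simp_rw [h.gammaFactor_def]
    exact differentiable_Gammaℝ_inv
  · simp_rw [h.gammaFactor_def]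
    exact differentiable_Gammaℝ_inv.comp (differentiable_id.add_const 1)

variable [NeZero N]

theorem analyticOrderAt_LFunction_eq {χ : DirichletCharacter ℂ N} (hχ : χ ≠ 1) {s : ℂ}
    (hs : 0 < s.re) :
    analyticOrderAt (LFunction χ) s = analyticOrderAt (completedLFunction χ) s := by
  have h : LFunction χ = completedLFunction χ * fun s ↦ (gammaFactor χ s)⁻¹ := by
    ext z
    rw [LFunction_eq_completed_div_gammaFactor χ z (Or.inr fun h ↦ hχ (level_one' χ h)),
      div_eq_mul_inv]
    rfl
  rw [h, analyticOrderAt_mul ((differentiable_completedLFunction hχ).analyticAt _)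
    ((differentiable_gammaFactor_inv χ).analyticAt _),
    ((differentiable_gammaFactor_inv χ).analyticAt s).analyticOrderAt_eq_zero.2
    (inv_ne_zero (gammaFactor_ne_zero χ hs)), add_zero]

end DirichletCharacter

section

variable {ι : Type*} [Fintype ι] {N : ι → ℕ} [∀ i, NeZero (N i)] {c : ι → ℂ}
  {χ : ∀ i, DirichletCharacter ℂ (N i)}

theorem sum_mul_analyticOrderNatAt_completedLFunction_eq_zero (hprim : ∀ i, (χ i).IsPrimitive)
    (hχ : ∀ i, χ i ≠ 1)
    (hF : Tendsto (fun t : ℝ ↦ ‖primeSum (charSum c χ) t * (Real.log t : ℂ)‖ / √t) atTop (𝓝 0))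
    {ρ : ℂ} (hρ : ρ ≠ 1 / 2) :
    ∑ i, c i * analyticOrderNatAt (completedLFunction (χ i)) ρ = 0 := by
  have key {z : ℂ} (hz : 1 / 2 ≤ z.re) (hz' : z ≠ 1 / 2) :
      ∑ i, c i * analyticOrderNatAt (completedLFunction (χ i)) z = 0 := by
    rw [← sum_mul_analyticOrderNatAt_LFunction_eq_zero hχ hF hz hz']
    refine Finset.sum_congr rfl fun i _ ↦ ?_
    rw [analyticOrderNatAt, analyticOrderNatAt,
      analyticOrderAt_LFunction_eq (hχ i) (by linarith)]
  rcases le_or_gt (1 / 2) ρ.re with h | h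
  · exact key h hρ
  · have h1 : 1 - conj ρ ≠ 1 / 2 := fun h1 ↦ by
      have h2 := congrArg re h1
      simp at h2
      linarith
    rw [← key (by simp; linarith) h1]
    refine Finset.sum_congr rfl fun i _ ↦ ?_
    rw [analyticOrderNatAt, analyticOrderNatAt,
      analyticOrderAt_completedLFunction_one_sub (hprim i) (hχ i)]

end

theorem exists_int_sum_mul_eq_zero {ι α : Type*} [Fintype ι] {c : ι → ℂ} (hc : c ≠ 0)
    {m : ι → α → ℕ} {s : Set α} (h : ∀ a ∈ s, ∑ i, c i * m i a = 0) :
    ∃ n : ι → ℤ, n ≠ 0 ∧ ∀ a ∈ s, ∑ i, n i * (m i a : ℤ) = 0 := by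
  obtain ⟨i₀, hi₀⟩ := Function.ne_iff.1 hc
  obtain ⟨φ, hφ⟩ : ∃ φ : Module.Dual ℚ ℂ, φ (c i₀) ≠ 0 := by
    by_contra! H
    exact hi₀ ((Module.forall_dual_apply_eq_zero_iff ℚ _).1 H)
  obtain ⟨b, hb⟩ := IsLocalization.exist_integer_multiples_of_finite
    (nonZeroDivisors ℤ) fun i ↦ φ (c i)
  choose n hn using hb
  have hb0 : ((b : ℤ) : ℚ) ≠ 0 := by exact_mod_cast nonZeroDivisors.coe_ne_zero b
  have hn (i : ι) : (n i : ℚ) = b * φ (c i) := by simpa using hn i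
  refine ⟨n, fun h0 ↦ ?_, fun a ha ↦ ?_⟩
  · have h1 := hn i₀
    rw [h0] at h1
    simp only [Pi.zero_apply, Int.cast_zero, zero_eq_mul] at h1
    exact h1.elim hb0 hφ
  · have h1 : ∑ i, φ (c i) * m i a = 0 := by
      rw [← map_zero φ, ← h a ha, map_sum]
      refine Finset.sum_congr rfl fun i _ ↦ ?_
      rw [mul_comm (c i), ← nsmul_eq_mul, map_nsmul, nsmul_eq_mul, mul_comm]
    have h2 : ((∑ i, n i * (m i a : ℤ) : ℤ) : ℚ) = b * ∑ i, φ (c i) * m i a := by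
      push_cast
      rw [Finset.mul_sum]
      exact Finset.sum_congr rfl fun i _ ↦ by rw [hn]; ring
    rw [h1, mul_zero] at h2
    exact_mod_cast h2

section

variable {ι : Type*} {Λ : ι → ℂ → ℂ}

theorem analyticOrderAt_prod_pow (t : Finset ι) (hΛ : ∀ i, Differentiable ℂ (Λ i))
    (h0 : ∀ i, Λ i 0 ≠ 0) (e : ι → ℕ) (z : ℂ) :
    analyticOrderAt (fun s ↦ ∏ i ∈ t, Λ i s ^ e i) z =
      (∑ i ∈ t, e i * analyticOrderNatAt (Λ i) z : ℕ) := by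
  classical
  induction t using Finset.induction_on with
  | empty => simp [analyticAt_const.analyticOrderAt_eq_zero]
  | insert i t hi ih =>
    simp only [Finset.prod_insert hi, Finset.sum_insert hi]
    have h1 : Differentiable ℂ fun s ↦ ∏ i ∈ t, Λ i s ^ e i :=
      Differentiable.fun_finsetProd fun j _ ↦ (hΛ j).pow _
    have h2 : (fun s ↦ Λ i s ^ e i * ∏ j ∈ t, Λ j s ^ e j) =
        Λ i ^ e i * fun s ↦ ∏ j ∈ t, Λ j s ^ e j := rfl
    rw [h2, analyticOrderAt_mul (((hΛ i).analyticAt z).pow _) (h1.analyticAt z), ih,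
      analyticOrderAt_pow ((hΛ i).analyticAt z),
      ← Nat.cast_analyticOrderNatAt ((hΛ i).analyticOrderAt_ne_top (h0 i) z)]
    push_cast
    simp

theorem analyticOrderAt_prod_pow_mul_sub_pow (t : Finset ι) (hΛ : ∀ i, Differentiable ℂ (Λ i))
    (h0 : ∀ i, Λ i 0 ≠ 0) (e : ι → ℕ) (w : ℂ) (a : ℕ) (z : ℂ) :
    analyticOrderAt (fun s ↦ (∏ i ∈ t, Λ i s ^ e i) * (s - w) ^ a) z =
      ((∑ i ∈ t, e i * analyticOrderNatAt (Λ i) z) + (if z = w then a else 0) : ℕ) := by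
  have h1 : Differentiable ℂ fun s ↦ ∏ i ∈ t, Λ i s ^ e i :=
    Differentiable.fun_finsetProd fun j _ ↦ (hΛ j).pow _
  have h2 : (fun s ↦ (∏ i ∈ t, Λ i s ^ e i) * (s - w) ^ a) =
      (fun s ↦ ∏ i ∈ t, Λ i s ^ e i) * (· - w) ^ a := rfl
  rw [h2, analyticOrderAt_mul (h1.analyticAt z) (by fun_prop), analyticOrderAt_prod_pow t hΛ h0]
  push_cast
  congr 1
  split_ifs with h
  · rw [h, analyticOrderAt_centeredMonomial]
  · rw [analyticOrderAt_pow (by fun_prop), analyticOrderAt_id_sub_const_of_ne h]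
    simp

theorem logDeriv_prod_pow_mul_sub_pow (t : Finset ι) (hΛ : ∀ i, Differentiable ℂ (Λ i))
    (e : ι → ℕ) {w : ℂ} (a : ℕ) {s : ℂ} (hs : ∀ i, Λ i s ≠ 0) (hw : s ≠ w) :
    logDeriv (fun s ↦ (∏ i ∈ t, Λ i s ^ e i) * (s - w) ^ a) s =
      ∑ i ∈ t, e i * logDeriv (Λ i) s + a / (s - w) := by
  have h1 : Differentiable ℂ fun s ↦ ∏ i ∈ t, Λ i s ^ e i :=
    Differentiable.fun_finsetProd fun j _ ↦ (hΛ j).pow _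
  have hw' : s - w ≠ 0 := sub_ne_zero.2 hw
  rw [logDeriv_mul (f := fun s ↦ ∏ i ∈ t, Λ i s ^ e i) (g := fun s ↦ (s - w) ^ a) s
    (Finset.prod_ne_zero_iff.2 fun i _ ↦ pow_ne_zero _ (hs i))
    (pow_ne_zero _ hw') (h1 s) (by fun_prop),
    logDeriv_prod (f := fun i s ↦ Λ i s ^ e i) (fun i _ ↦ pow_ne_zero _ (hs i))
      fun i _ ↦ ((hΛ i).pow _) s]
  congr 1
  · exact Finset.sum_congr rfl fun i _ ↦ logDeriv_fun_pow (hΛ i s) _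
  · rw [logDeriv_fun_pow (by fun_prop), logDeriv_apply]
    simp [div_eq_mul_inv]

theorem exists_sum_mul_logDeriv_eq [Fintype ι] (hΛ : ∀ i, Differentiable ℂ (Λ i))
    (h0 : ∀ i, Λ i 0 ≠ 0) (hg : ∀ i, HasQuadraticGrowth (Λ i)) {n : ι → ℤ} {w : ℂ} (hw : w ≠ 0)
    (hn : ∀ z ∈ {z | z ≠ w}, ∑ i, n i * (analyticOrderNatAt (Λ i) z : ℤ) = 0) :
    ∃ (P : Polynomial ℂ) (k : ℂ), ∀ s, (∀ i, Λ i s ≠ 0) → s ≠ w →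
      ∑ i, n i * logDeriv (Λ i) s = P.eval s + k / (s - w) := by
  let e₁ : ι → ℕ := fun i ↦ (n i).toNat
  let e₂ : ι → ℕ := fun i ↦ (-n i).toNat
  have he (i : ι) : n i = (e₁ i : ℤ) - e₂ i := (Int.toNat_sub_toNat_neg (n i)).symm
  let a₁ := ∑ i, e₁ i * analyticOrderNatAt (Λ i) w
  let a₂ := ∑ i, e₂ i * analyticOrderNatAt (Λ i) w
  have hd (e : ι → ℕ) (a : ℕ) : Differentiable ℂ fun s ↦ (∏ i, Λ i s ^ e i) * (s - w) ^ a :=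
    (Differentiable.fun_finsetProd fun j _ ↦ (hΛ j).pow _).mul (by fun_prop)
  have hq (e : ι → ℕ) (a : ℕ) : HasQuadraticGrowth fun s ↦ (∏ i, Λ i s ^ e i) * (s - w) ^ a :=
    (HasQuadraticGrowth.prod Finset.univ fun i ↦ (hg i).pow (e i)).mul
      ((hasQuadraticGrowth_sub_const w).pow a)
  obtain ⟨P, hP⟩ := exists_polynomial_eq_mul_cexp (hd e₁ a₂) (hd e₂ a₁) (hq e₁ a₂) (hq e₂ a₁)
    (mul_ne_zero (Finset.prod_ne_zero_iff.2 fun i _ ↦ pow_ne_zero _ (h0 i))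
      (pow_ne_zero _ (by simpa using hw))) fun z ↦ by
    rw [analyticOrderAt_prod_pow_mul_sub_pow _ hΛ h0, analyticOrderAt_prod_pow_mul_sub_pow _ hΛ h0]
    congr 1
    by_cases hz : z = w
    · subst hz
      simp only [if_true]
      exact add_comm _ _
    · have := hn z hz
      simp only [he, sub_mul, Finset.sum_sub_distrib] at this
      simp only [hz, if_false, add_zero]
      exact_mod_cast sub_eq_zero.1 this
  refine ⟨P.derivative, a₁ - a₂, fun s hs hsw ↦ ?_⟩
  have h1 := logDeriv_prod_pow_mul_sub_pow Finset.univ hΛ e₁ a₂ hs hsw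
  have h2 := logDeriv_prod_pow_mul_sub_pow Finset.univ hΛ e₂ a₁ hs hsw
  have h3 : logDeriv (fun s ↦ cexp (P.eval s)) s = P.derivative.eval s := by
    rw [logDeriv_apply, ((P.hasDerivAt s).cexp).deriv,
      mul_div_cancel_left₀ _ (Complex.exp_ne_zero _)]
  rw [funext hP, logDeriv_mul (f := fun s ↦ (∏ i, Λ i s ^ e₂ i) * (s - w) ^ a₁)
    (g := fun s ↦ cexp (P.eval s)) s (mul_ne_zero (Finset.prod_ne_zero_iff.2 fun i _ ↦
    pow_ne_zero _ (hs i)) (pow_ne_zero _ (sub_ne_zero.2 hsw))) (Complex.exp_ne_zero _) (hd e₂ a₁ s)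
    (P.differentiable.cexp s), h2, h3] at h1
  have h4 : ∑ i, (n i : ℂ) * logDeriv (Λ i) s =
      ∑ i, (e₁ i : ℂ) * logDeriv (Λ i) s - ∑ i, (e₂ i : ℂ) * logDeriv (Λ i) s := by
    rw [← Finset.sum_sub_distrib]
    refine Finset.sum_congr rfl fun i _ ↦ ?_
    rw [he]
    push_cast
    ring
  rw [h4, sub_div]
  linear_combination -h1

end

namespace DirichletCharacter

theorem differentiableAt_gammaFactor {N : ℕ} (χ : DirichletCharacter ℂ N) {s : ℂ}
    (hs : 0 < s.re) : DifferentiableAt ℂ (gammaFactor χ) s := by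
  simpa only [inv_inv] using
    (differentiable_gammaFactor_inv χ s).fun_inv (inv_ne_zero (gammaFactor_ne_zero χ hs))

theorem logDeriv_completedLFunction {N : ℕ} [NeZero N] {χ : DirichletCharacter ℂ N} (hχ : χ ≠ 1)
    {s : ℂ} (hs : 1 ≤ s.re) :
    logDeriv (completedLFunction χ) s =
      logDeriv (LFunction χ) s + logDeriv (gammaFactor χ) s := by
  have hs0 : 0 < s.re := by linarith
  rw [← logDeriv_mul s (LFunction_ne_zero_of_one_le_re χ (.inl hχ) hs)
    (gammaFactor_ne_zero χ hs0) (differentiable_LFunction hχ s)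
    (differentiableAt_gammaFactor χ hs0)]
  refine (logDeriv_congr_nhds ?_).eq_of_nhds
  filter_upwards [(isOpen_lt continuous_const continuous_re).mem_nhds hs0] with z hz
  exact completedLFunction_eq_mul_gammaFactor hχ hz

theorem completedLFunction_ne_zero_of_one_le_re {N : ℕ} [NeZero N] {χ : DirichletCharacter ℂ N}
    (hχ : χ ≠ 1) {s : ℂ} (hs : 1 ≤ s.re) : completedLFunction χ s ≠ 0 := by
  rw [completedLFunction_eq_mul_gammaFactor hχ (by linarith)]
  exact mul_ne_zero (LFunction_ne_zero_of_one_le_re χ (.inl hχ) hs)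
    (gammaFactor_ne_zero χ (by linarith))

theorem exists_gammaFactor_add_two_eq {N : ℕ} (χ : DirichletCharacter ℂ N) :
    ∃ κ : ℂ, (κ = 0 ∨ κ = 1) ∧
      ∀ s : ℂ, 0 < s.re → gammaFactor χ (s + 2) = gammaFactor χ s * (s + κ) / 2 / π := by
  rcases χ.even_or_odd with h | h
  · refine ⟨0, .inl rfl, fun s hs ↦ ?_⟩
    rw [h.gammaFactor_def, h.gammaFactor_def,
      Gammaℝ_add_two (by rintro rfl; simp at hs), add_zero]
  · refine ⟨1, .inr rfl, fun s hs ↦ ?_⟩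
    have h1 : s + 1 ≠ 0 := fun h ↦ by
      have := congrArg re h
      simp at this
      linarith
    rw [h.gammaFactor_def, h.gammaFactor_def, ← Gammaℝ_add_two h1, add_right_comm]

theorem exists_logDeriv_gammaFactor_add_two_sub_eq {N : ℕ} (χ : DirichletCharacter ℂ N) :
    ∃ a b : ℂ, ∀ s : ℂ, 0 < s.re →
      logDeriv (gammaFactor χ) (s + 2) - logDeriv (gammaFactor χ) s = a / s + b / (s + 1) := by
  obtain ⟨κ, hκ, h⟩ := exists_gammaFactor_add_two_eq χ
  have key (s : ℂ) (hs : 0 < s.re) :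
      logDeriv (gammaFactor χ) (s + 2) - logDeriv (gammaFactor χ) s = 1 / (s + κ) := by
    have hκ0 : s + κ ≠ 0 := fun h0 ↦ by
      have := congrArg re h0
      rcases hκ with rfl | rfl <;> simp at this <;> linarith
    have hπ : (2 * π : ℂ) ≠ 0 := by simp [Real.pi_ne_zero]
    have h1 : (fun z ↦ gammaFactor χ (z + 2)) =ᶠ[𝓝 s]
        fun z ↦ gammaFactor χ z * ((z + κ) / (2 * π)) := by
      filter_upwards [(isOpen_lt continuous_const continuous_re).mem_nhds hs] with z hz
      rw [h z hz]
      ring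
    have h2 := (logDeriv_congr_nhds h1).eq_of_nhds
    rw [logDeriv_mul (g := fun z ↦ (z + κ) / (2 * π)) s (gammaFactor_ne_zero χ hs)
      (div_ne_zero hκ0 hπ) (differentiableAt_gammaFactor χ hs)
      ((differentiableAt_id.add_const κ).div_const _)] at h2
    have h3 : logDeriv (fun z ↦ gammaFactor χ (z + 2)) s = logDeriv (gammaFactor χ) (s + 2) := by
      rw [logDeriv_apply, logDeriv_apply, deriv_comp_add_const]
    have h4 : logDeriv (fun z : ℂ ↦ (z + κ) / (2 * π)) s = 1 / (s + κ) := by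
      rw [logDeriv_apply, deriv_div_const, deriv_add_const, deriv_id'']
      field_simp
    rw [← h3, h2, h4]
    ring
  rcases hκ with rfl | rfl
  · exact ⟨1, 0, fun s hs ↦ by rw [key s hs]; simp⟩
  · exact ⟨0, 1, fun s hs ↦ by rw [key s hs]; simp⟩

end DirichletCharacter

theorem Polynomial.tendsto_eval_mul_two_cpow_neg (D : Polynomial ℂ) :
    Tendsto (fun x : ℝ ↦ D.eval (x : ℂ) * (2 : ℂ) ^ (-x : ℂ)) atTop (𝓝 0) := by
  induction D using Polynomial.induction_on' with
  | add p q hp hq =>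
    simpa [add_mul] using hp.add hq
  | monomial n a =>
    have h1 : Tendsto (fun x : ℝ ↦ x ^ n * rexp (-(Real.log 2) * x)) atTop (𝓝 0) := by
      have := tendsto_rpow_mul_exp_neg_mul_atTop_nhds_zero n (Real.log 2)
        (Real.log_pos one_lt_two)
      simpa only [Real.rpow_natCast] using this
    have h2 := ((continuous_ofReal.tendsto' 0 0 ofReal_zero).comp h1).const_mul a
    rw [mul_zero] at h2
    refine h2.congr fun x ↦ ?_
    simp only [Function.comp, Polynomial.eval_monomial]
    rw [Complex.cpow_def_of_ne_zero two_ne_zero, ← ofReal_ofNat, ← Complex.ofReal_log (by norm_num)]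
    push_cast
    ring_nf

theorem eq_zero_of_polynomial_mul_LSeries_eq {f : ℕ → ℂ} (h0 : f 0 = 0) (h1 : f 1 = 0)
    (ha : LSeries.abscissaOfAbsConv f < ⊤) {D Q : Polynomial ℂ} (hD : D ≠ 0)
    (h : ∀ᶠ x : ℝ in atTop, D.eval (x : ℂ) * LSeries f x = Q.eval (x : ℂ)) {n : ℕ} (hn : n ≠ 0) :
    f n = 0 := by
  have hx : Tendsto (fun x : ℝ ↦ ‖(x : ℂ)‖) atTop atTop := by
    simpa using tendsto_abs_atTop_atTop
  have hlim : Tendsto (fun x : ℝ ↦ Q.eval (x : ℂ)) atTop (𝓝 0) := by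
    have hf := LSeries.tendsto_cpow_mul_atTop (n := 1) (fun m hm ↦ by
      interval_cases m <;> assumption) ha
    have h2 := D.tendsto_eval_mul_two_cpow_neg.mul hf
    rw [zero_mul] at h2
    refine h2.congr' ?_
    filter_upwards [h] with x hx
    rw [← hx, Complex.cpow_neg]
    have : (2 : ℂ) ^ (x : ℂ) ≠ 0 := by simp [Complex.cpow_eq_zero_iff]
    norm_num
    field_simp
  have hQ : Q = 0 := by
    by_contra hQ
    have hdeg : Q.degree ≤ 0 := by
      by_contra! hdeg
      exact not_tendsto_nhds_of_tendsto_atTop (Q.tendsto_norm_atTop hdeg hx) _ hlim.norm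
    rw [Polynomial.eq_C_of_degree_le_zero hdeg] at hlim hQ
    simp only [Polynomial.eval_C, tendsto_const_nhds_iff] at hlim
    exact hQ (by rw [hlim, map_zero])
  have hD0 : ∀ᶠ x : ℝ in atTop, D.eval (x : ℂ) ≠ 0 := by
    rcases le_or_gt D.degree 0 with hdeg | hdeg
    · rw [Polynomial.eq_C_of_degree_le_zero hdeg] at hD ⊢
      exact .of_forall fun x hx ↦ hD (by simpa using hx)
    · filter_upwards [(D.tendsto_norm_atTop hdeg hx).eventually_gt_atTop 0] with x hx
      exact norm_pos_iff.1 hx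
  refine (LSeries_eventually_eq_zero_iff'.1 ?_).resolve_right ha.ne n hn
  filter_upwards [h, hD0] with x hx hx0
  rw [hQ, Polynomial.eval_zero] at hx
  exact (mul_eq_zero.1 hx).resolve_left hx0

theorem LSeries.term_mul_inv_sq (u : ℕ → ℂ) (s : ℂ) (n : ℕ) :
    LSeries.term (fun n ↦ u n * ((n : ℂ) ^ 2)⁻¹) s n = LSeries.term u (s + 2) n := by
  rcases eq_or_ne n 0 with rfl | hn
  · simp
  · have hn' : (n : ℂ) ≠ 0 := Nat.cast_ne_zero.2 hn
    rw [LSeries.term_of_ne_zero hn, LSeries.term_of_ne_zero hn, Complex.cpow_add _ _ hn',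
      Complex.cpow_ofNat, ← div_eq_mul_inv, div_div, mul_comm]

theorem lseriesHasSum_mul_one_sub_inv_sq {u : ℕ → ℂ} {s : ℂ} (hs : LSeriesSummable u s) :
    LSeriesHasSum (fun n ↦ u n * (1 - ((n : ℂ) ^ 2)⁻¹)) s (LSeries u s - LSeries u (s + 2)) := by
  have hs2 : LSeriesSummable u (s + 2) := hs.of_re_le_re (by simp)
  have h1 : (fun n ↦ u n * (1 - ((n : ℂ) ^ 2)⁻¹)) = u - fun n ↦ u n * ((n : ℂ) ^ 2)⁻¹ := by
    ext n
    simp [mul_sub]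
  rw [h1]
  refine hs.LSeriesHasSum.sub ?_
  rw [LSeriesHasSum, funext (LSeries.term_mul_inv_sq u s)]
  exact hs2.LSeriesHasSum

section

variable {ι : Type*} [Fintype ι] {N : ι → ℕ} [∀ i, NeZero (N i)] {c : ι → ℂ}
  {χ : ∀ i, DirichletCharacter ℂ (N i)}

theorem exists_polynomial_sum_logDeriv_LFunction_sub_eq (hχ : ∀ i, χ i ≠ 1)
    {P : Polynomial ℂ} {k : ℂ} {n : ι → ℤ}
    (h : ∀ s, (∀ i, completedLFunction (χ i) s ≠ 0) → s ≠ 1 / 2 →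
      ∑ i, n i * logDeriv (completedLFunction (χ i)) s = P.eval s + k / (s - 1 / 2)) :
    ∃ Q : Polynomial ℂ, ∀ s : ℂ, 1 < s.re →
      s * (s + 1) * (s - 1 / 2) * (s + 3 / 2) * (∑ i, n i * logDeriv (LFunction (χ i)) (s + 2) -
        ∑ i, n i * logDeriv (LFunction (χ i)) s) = Q.eval s := by
  choose a b hab using fun i ↦ exists_logDeriv_gammaFactor_add_two_sub_eq (χ i)
  have hG {s : ℂ} (hs : 1 < s.re) : ∑ i, n i * logDeriv (LFunction (χ i)) s =
      P.eval s + k / (s - 1 / 2) - ∑ i, n i * logDeriv (gammaFactor (χ i)) s := by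
    rw [← h s (fun i ↦ completedLFunction_ne_zero_of_one_le_re (hχ i) hs.le)
      (by rintro rfl; norm_num at hs), ← Finset.sum_sub_distrib]
    refine Finset.sum_congr rfl fun i _ ↦ ?_
    rw [logDeriv_completedLFunction (hχ i) hs.le]
    ring
  refine ⟨.X * (.X + .C 1) * (.X - .C (1 / 2)) * (.X + .C (3 / 2)) *
    (P.comp (.X + .C 2) - P) + .C k * (.X * (.X + .C 1) * (.X - .C (1 / 2))) -
    .C k * (.X * (.X + .C 1) * (.X + .C (3 / 2))) -
    .C (∑ i, n i * a i) * ((.X + .C 1) * (.X - .C (1 / 2)) * (.X + .C (3 / 2))) -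
    .C (∑ i, n i * b i) * (.X * (.X - .C (1 / 2)) * (.X + .C (3 / 2))), fun s hs ↦ ?_⟩
  have h0 : s ≠ 0 := by rintro rfl; norm_num at hs
  have h1 : s + 1 ≠ 0 := fun h ↦ by
    have := congrArg re h
    simp at this
    linarith
  have h2 : s - 1 / 2 ≠ 0 := fun h ↦ by
    have := congrArg re h
    simp at this
    linarith
  have h3 : s + 3 / 2 ≠ 0 := fun h ↦ by
    have := congrArg re h
    simp at this
    linarith
  have hγ : ∑ i, n i * logDeriv (gammaFactor (χ i)) (s + 2) =
      ∑ i, n i * logDeriv (gammaFactor (χ i)) s + (∑ i, n i * a i) / s +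
        (∑ i, n i * b i) / (s + 1) := by
    rw [Finset.sum_div, Finset.sum_div, ← Finset.sum_add_distrib, ← Finset.sum_add_distrib]
    refine Finset.sum_congr rfl fun i _ ↦ ?_
    linear_combination n i * hab i s (by linarith)
  rw [hG hs, hG (s := s + 2) (by simp; linarith), hγ, show s + 2 - 1 / 2 = s + 3 / 2 by ring]
  simp only [Polynomial.eval_add, Polynomial.eval_sub, Polynomial.eval_mul, Polynomial.eval_X,
    Polynomial.eval_C, Polynomial.eval_comp, div_eq_mul_inv _ s, div_eq_mul_inv _ (s + 1),
    div_eq_mul_inv _ (s - 1 / 2), div_eq_mul_inv _ (s + 3 / 2)]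
  linear_combination
    k * (s * (s + 1) * (s - 1 / 2)) * mul_inv_cancel₀ h3 -
    k * (s * (s + 1) * (s + 3 / 2)) * mul_inv_cancel₀ h2 -
    (∑ i, n i * a i) * ((s + 1) * (s - 1 / 2) * (s + 3 / 2)) * mul_inv_cancel₀ h0 -
    (∑ i, n i * b i) * (s * (s - 1 / 2) * (s + 3 / 2)) * mul_inv_cancel₀ h1

theorem exists_int_charSum_prime_eq_zero (hprim : ∀ i, (χ i).IsPrimitive) (hχ : ∀ i, χ i ≠ 1)
    (hc : c ≠ 0)
    (hF : Tendsto (fun t : ℝ ↦ ‖primeSum (charSum c χ) t * (Real.log t : ℂ)‖ / √t) atTop (𝓝 0)) :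
    ∃ n : ι → ℤ, n ≠ 0 ∧ ∀ p : ℕ, p.Prime → charSum (fun i ↦ (n i : ℂ)) χ p = 0 := by
  obtain ⟨n, hn, hsum⟩ := exists_int_sum_mul_eq_zero hc (s := {z | z ≠ 1 / 2}) fun z hz ↦
    sum_mul_analyticOrderNatAt_completedLFunction_eq_zero hprim hχ hF hz
  obtain ⟨P, k, hPk⟩ := exists_sum_mul_logDeriv_eq
    (fun i ↦ differentiable_completedLFunction (hχ i))
    (fun i ↦ completedLFunction_zero_ne_zero (hprim i) (hχ i))
    (fun i ↦ hasQuadraticGrowth_completedLFunction (hprim i) (hχ i)) (by norm_num) hsum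
  obtain ⟨Q, hQ⟩ := exists_polynomial_sum_logDeriv_LFunction_sub_eq hχ hPk
  refine ⟨n, hn, fun p hp ↦ ?_⟩
  set w := charSum (fun i ↦ (n i : ℂ)) χ with hw
  set u : ℕ → ℂ := fun m ↦ w m * vonMangoldt m with hu
  have hus {s : ℂ} (hs : 1 < s.re) : LSeriesSummable u s := by
    have h : u = ∑ i, (n i : ℂ) • fun m : ℕ ↦ (χ i m * vonMangoldt m : ℂ) := by
      ext m
      simp [hu, hw, charSum, Finset.sum_mul, mul_assoc]
    rw [h]
    exact LSeriesSummable.sum fun i _ ↦ (LSeriesSummable_twist_vonMangoldt (χ i) hs).smul _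
  have hfs : LSeriesSummable (fun m ↦ u m * (1 - ((m : ℂ) ^ 2)⁻¹)) 2 :=
    (lseriesHasSum_mul_one_sub_inv_sq (hus (by simp))).LSeriesSummable
  have hD : (.X * (.X + .C 1) * (.X - .C (1 / 2)) * (.X + .C (3 / 2)) : Polynomial ℂ) ≠ 0 :=
    mul_ne_zero (mul_ne_zero (mul_ne_zero Polynomial.X_ne_zero (Polynomial.X_add_C_ne_zero _))
      (Polynomial.X_sub_C_ne_zero _)) (Polynomial.X_add_C_ne_zero _)
  have key := eq_zero_of_polynomial_mul_LSeries_eq (Q := Q)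
    (f := fun m ↦ u m * (1 - ((m : ℂ) ^ 2)⁻¹)) (by simp [hu]) (by simp)
    (hfs.abscissaOfAbsConv_le.trans_lt (EReal.coe_lt_top _)) hD
    (by
      filter_upwards [eventually_gt_atTop 1] with x hx
      have hx' : 1 < (x : ℂ).re := by simpa using hx
      rw [(lseriesHasSum_mul_one_sub_inv_sq (hus hx')).LSeries_eq, ← hQ x hx', hu, hw,
        LSeries_charSum_mul_vonMangoldt _ _ hx',
        LSeries_charSum_mul_vonMangoldt _ _ (s := x + 2) (by simp; linarith)]
      simp only [Polynomial.eval_add, Polynomial.eval_sub, Polynomial.eval_mul, Polynomial.eval_X,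
        Polynomial.eval_C]
      ring) hp.ne_zero
  have hp1 : (1 : ℂ) - ((p : ℂ) ^ 2)⁻¹ ≠ 0 := by
    rw [sub_ne_zero, ne_comm, ne_eq, inv_eq_one]
    exact_mod_cast (Nat.one_lt_pow two_ne_zero hp.one_lt).ne'
  have hp2 : (vonMangoldt p : ℂ) ≠ 0 := by
    rw [ArithmeticFunction.vonMangoldt_apply_prime hp]
    exact_mod_cast (Real.log_pos (by exact_mod_cast hp.one_lt)).ne'
  simpa [hu, hp1, hp2] using key

end

section

variable {q : ℕ} [NeZero q]

namespace DirichletCharacter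

omit [NeZero q] in
theorem primitiveCharacter_apply_of_coprime (χ : DirichletCharacter ℂ q) {n : ℕ}
    (hn : IsUnit (n : ZMod q)) : χ.primitiveCharacter n = χ n := by
  have h := χ.primitiveCharacter_apply_of_isCoprime (a := n)
    (Nat.isCoprime_iff_coprime.2 ((ZMod.isUnit_iff_coprime n q).1 hn))
  simpa using h

omit [NeZero q] in
theorem primitiveCharacter_ne_one {χ : DirichletCharacter ℂ q} (hχ : χ ≠ 1) :
    χ.primitiveCharacter ≠ 1 := fun h ↦ hχ (by
  rw [← χ.changeLevel_primitiveCharacter, h, changeLevel_one])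

theorem eq_zero_of_forall_prime_sum_mul_eq_zero {n : {χ : DirichletCharacter ℂ q // χ ≠ 1} → ℂ}
    (h : ∀ p : ℕ, p.Prime → IsUnit (p : ZMod q) → ∑ i, n i * i.1 p = 0) : n = 0 := by
  have hinj : Function.Injective
      fun i : {χ : DirichletCharacter ℂ q // χ ≠ 1} ↦ i.1.toMonoidHom := fun i j hij ↦
    Subtype.ext (MulChar.ext' fun x ↦ DFunLike.congr_fun (F := ZMod q →* ℂ) hij x)
  have hli := (linearIndependent_monoidHom (ZMod q) ℂ).comp _ hinj
  refine funext (Fintype.linearIndependent_iff.1 hli n (funext fun b ↦ ?_))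
  simp only [Finset.sum_apply, Pi.smul_apply, smul_eq_mul, Pi.zero_apply]
  change ∑ i, n i * i.1 b = 0
  by_cases hb : IsUnit b
  · obtain ⟨p, -, hp, rfl⟩ := Nat.forall_exists_prime_gt_and_eq_mod hb 0
    exact h p hp hb
  · exact Finset.sum_eq_zero fun i _ ↦ mul_eq_zero_of_right _ (i.1.map_nonunit hb)

/-- The Fourier coefficients of the indicator function of the residue classes `a j`. -/
noncomputable def classCoeff {r : ℕ} (a : Fin r → ZMod q) (χ : DirichletCharacter ℂ q) : ℂ :=
  (q.totient : ℂ)⁻¹ * ∑ j, χ (a j)⁻¹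

open scoped Classical in
theorem sum_classCoeff_mul {r : ℕ} {a : Fin r → ZMod q} (ha : Function.Injective a)
    (haq : ∀ j, IsUnit (a j)) {b : ZMod q} (hb : IsUnit b) :
    ∑ i : {χ : DirichletCharacter ℂ q // χ ≠ 1}, classCoeff a i.1 * i.1 b =
      (if ∃ j, a j = b then 1 else 0) - (r : ℂ) / q.totient := by
  have hq : (q.totient : ℂ) ≠ 0 := by
    exact_mod_cast (Nat.totient_pos.2 (NeZero.pos q)).ne'
  have h1 := Fintype.sum_eq_add_sum_subtype_ne
    (fun χ : DirichletCharacter ℂ q ↦ classCoeff a χ * χ b) 1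
  have h2 : classCoeff a 1 * (1 : DirichletCharacter ℂ q) b = (r : ℂ) / q.totient := by
    have (j : Fin r) : (1 : DirichletCharacter ℂ q) (a j)⁻¹ = 1 := by
      obtain ⟨v, hv⟩ := haq j
      rw [← hv, ZMod.inv_coe_unit]
      exact MulChar.one_apply_coe _
    simp only [classCoeff, this, MulChar.one_apply hb]
    simp
    ring
  have h3 : ∑ χ : DirichletCharacter ℂ q, classCoeff a χ * χ b = if ∃ j, a j = b then 1 else 0 := by
    simp only [classCoeff, mul_assoc, ← Finset.mul_sum, Finset.sum_mul]
    rw [Finset.sum_comm]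
    simp only [sum_char_inv_mul_char_eq ℂ (haq _)]
    split_ifs with h
    · obtain ⟨j, rfl⟩ := h
      simp [ha.eq_iff, hq]
    · simp [not_exists.1 h]
  rw [← h3, h1, h2]
  ring

theorem exists_classCoeff_ne_zero {r : ℕ} {a : Fin r → ZMod q} (ha : Function.Injective a)
    (haq : ∀ j, IsUnit (a j)) (hr : 1 ≤ r) (hrq : r < q.totient) :
    (fun i : {χ : DirichletCharacter ℂ q // χ ≠ 1} ↦ classCoeff a i.1) ≠ 0 := fun h ↦ by
  have h1 := sum_classCoeff_mul ha haq (haq ⟨0, hr⟩)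
  have h2 (i : {χ : DirichletCharacter ℂ q // χ ≠ 1}) : classCoeff a i.1 = 0 := congrFun h i
  rw [if_pos ⟨_, rfl⟩] at h1
  simp only [h2, zero_mul, Finset.sum_const_zero] at h1
  have h3 : (r : ℂ) / q.totient = 1 := by linear_combination h1
  have hq : (q.totient : ℂ) ≠ 0 := by exact_mod_cast (by omega : q.totient ≠ 0)
  rw [div_eq_one_iff_eq hq] at h3
  exact hrq.ne (by exact_mod_cast h3)

end DirichletCharacter

/-- The prime sums of the nonprincipal part of the indicator function of a proper nonempty set of
invertible residue classes are not `o(√t / log t)`. -/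
theorem not_tendsto_primeSum_classCoeff {r : ℕ} {a : Fin r → ZMod q} (ha : Function.Injective a)
    (haq : ∀ j, IsUnit (a j)) (hr : 1 ≤ r) (hrq : r < q.totient) :
    ¬ Tendsto (fun t : ℝ ↦ ‖primeSum (charSum
      (fun i : {χ : DirichletCharacter ℂ q // χ ≠ 1} ↦ classCoeff a i.1)
      fun i ↦ i.1.primitiveCharacter) t * (Real.log t : ℂ)‖ / √t) atTop (𝓝 0) := fun hF ↦ by
  have (i : {χ : DirichletCharacter ℂ q // χ ≠ 1}) : NeZero i.1.conductor :=
    ⟨i.1.conductor_ne_zero⟩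
  obtain ⟨n, hn, h⟩ := exists_int_charSum_prime_eq_zero
    (fun i ↦ i.1.primitiveCharacter_isPrimitive) (fun i ↦ primitiveCharacter_ne_one i.2)
    (exists_classCoeff_ne_zero ha haq hr hrq) hF
  have h0 := eq_zero_of_forall_prime_sum_mul_eq_zero (n := fun i ↦ (n i : ℂ)) fun p hp hpq ↦ by
    rw [← h p hp, charSum]
    exact Finset.sum_congr rfl fun i _ ↦ by rw [primitiveCharacter_apply_of_coprime _ hpq]
  exact hn (funext fun i ↦ Int.cast_eq_zero.1 (congrFun h0 i))

end

theorem natCount_eq_sum {P : Set ℕ} [DecidablePred (· ∈ P)] (hP : ∀ p ∈ P, p.Prime) (x : ℝ) :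
    (natCount P x : ℂ) = ∑ k ∈ Finset.Icc 1 ⌊x⌋₊, if k ∈ P then 1 else 0 := by
  rw [Finset.sum_boole, natCount, ← Set.ncard_coe_finset]
  congr 2
  ext p
  simp only [Set.mem_ofPred_eq, Finset.coe_filter, Finset.mem_Icc]
  constructor
  · exact fun ⟨h1, h2⟩ ↦ ⟨⟨(hP p h1).one_le, Nat.le_floor h2⟩, h1⟩
  · exact fun ⟨⟨h1, h2⟩, h3⟩ ↦ ⟨h3, (Nat.le_floor_iff' (by omega)).1 h2⟩

theorem exists_norm_sum_le_of_support_finite {g : ℕ → ℂ} {S : Set ℕ} (hS : S.Finite)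
    (hg : ∀ k ∉ S, g k = 0) : ∃ C, ∀ s : Finset ℕ, ‖∑ k ∈ s, g k‖ ≤ C := by
  classical
  refine ⟨∑ k ∈ hS.toFinset, ‖g k‖, fun s ↦ ?_⟩
  rw [← Finset.sum_filter_of_ne (p := (· ∈ S)) fun k _ hk ↦ by_contra fun h ↦ hk (hg k h)]
  refine (norm_sum_le _ _).trans (Finset.sum_le_sum_of_subset_of_nonneg (fun k hk ↦ ?_)
    fun _ _ _ ↦ norm_nonneg _)
  simpa using (Finset.mem_filter.1 hk).2

theorem exists_norm_primeSum_classCoeff_sub_le {q : ℕ} [NeZero q] {r : ℕ} {a : Fin r → ZMod q}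
    (ha : Function.Injective a) (haq : ∀ j, IsUnit (a j)) {P : Set ℕ} (hP : ∀ p ∈ P, p.Prime)
    (hfin : (symmDiff P (⋃ j, residueClassPrimes q (a j))).Finite) :
    ∃ C, ∀ x : ℝ, ‖primeSum (charSum
        (fun i : {χ : DirichletCharacter ℂ q // χ ≠ 1} ↦ classCoeff a i.1)
        fun i ↦ i.1.primitiveCharacter) x -
      (natCount P x - (r : ℂ) / q.totient * primePi x)‖ ≤ C := by
  classical
  set u := charSum (fun i : {χ : DirichletCharacter ℂ q // χ ≠ 1} ↦ classCoeff a i.1)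
    fun i ↦ i.1.primitiveCharacter with hu
  have hS : (symmDiff P (⋃ j, residueClassPrimes q (a j)) ∪ {p | p ∣ q}).Finite :=
    hfin.union ((Set.finite_le_nat q).subset fun p hp ↦ Nat.le_of_dvd (NeZero.pos q) hp)
  obtain ⟨C, hC⟩ := exists_norm_sum_le_of_support_finite
    (g := fun k ↦ primePart u k - ((if k ∈ P then 1 else 0) -
      (r : ℂ) / q.totient * if k ∈ {p : ℕ | p.Prime} then 1 else 0)) hS fun k hk ↦ by
    by_cases hp : k.Prime
    · have hkq : IsUnit (k : ZMod q) := by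
        rw [ZMod.isUnit_iff_coprime, hp.coprime_iff_not_dvd]
        exact fun h ↦ hk (.inr h)
      have hkP : k ∈ P ↔ ∃ j, a j = k := by
        have h : k ∈ P ↔ k ∈ ⋃ j, residueClassPrimes q (a j) := by
          have h := fun h ↦ hk (.inl h)
          rw [Set.mem_symmDiff] at h
          tauto
        simp [h, residueClassPrimes, hp, eq_comm]
      have h1 : u k = (if ∃ j, a j = k then 1 else 0) - (r : ℂ) / q.totient := by
        rw [← sum_classCoeff_mul ha haq hkq]
        exact Finset.sum_congr rfl fun i _ ↦ by rw [primitiveCharacter_apply_of_coprime _ hkq]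
      simp [primePart, hp, h1, hkP]
    · simp [primePart, hp, mt (hP k) hp]
  refine ⟨C, fun x ↦ (hC (Finset.Icc 1 ⌊x⌋₊)).trans' (le_of_eq ?_)⟩
  rw [Finset.sum_sub_distrib, Finset.sum_sub_distrib, ← Finset.mul_sum, ← natCount_eq_sum hP,
    ← natCount_eq_sum (P := {p | p.Prime}) fun p hp ↦ hp]
  rfl

theorem tendsto_of_not_isOmega {f : ℝ → ℝ} (h : ¬ IsOmega f fun x ↦ √x / Real.log x) :
    Tendsto (fun x ↦ |f x| * Real.log x / √x) atTop (𝓝 0) := by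
  simp only [IsOmega, not_exists, not_and, not_forall, not_le] at h
  rw [Metric.tendsto_atTop]
  intro ε hε
  obtain ⟨X, hX⟩ := h ε hε
  refine ⟨max X 2, fun x hx ↦ ?_⟩
  have hx2 : 2 ≤ x := le_of_max_le_right hx
  have h1 := hX x (le_of_max_le_left hx)
  have hl : 0 < Real.log x := Real.log_pos (by linarith)
  have hs : 0 < √x := Real.sqrt_pos.2 (by linarith)
  rw [Real.dist_eq, sub_zero, abs_of_nonneg (by positivity), div_lt_iff₀ hs]
  rwa [← mul_div_assoc, lt_div_iff₀ hl] at h1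

/-- If `P` is, up to finitely many exceptions, the union of the primes in `r` distinct
invertible residue classes `a₁, …, a_r` mod `q`, with `1 ≤ r < φ(q)`, then
`P(x) - (r/φ(q))·π(x) = Ω(x^{1/2}/log x)`. -/
theorem residue_class_union_omega (q : ℕ) (hq : 0 < q) (r : ℕ) (hr : 1 ≤ r)
    (hrphi : r < Nat.totient q)
    (a : Fin r → ZMod q) (ha : Function.Injective a) (haq : ∀ j, IsUnit (a j))
    (P : Set ℕ) (hP : ∀ p ∈ P, p.Prime)
    (hfin : (symmDiff P (⋃ j, residueClassPrimes q (a j))).Finite) :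
    IsOmega
      (fun x : ℝ => (natCount P x : ℝ) - ((r : ℝ) / Nat.totient q) * primePi x)
      (fun x : ℝ => Real.sqrt x / Real.log x) := by
  have : NeZero q := ⟨hq.ne'⟩
  by_contra hΩ
  refine not_tendsto_primeSum_classCoeff ha haq hr hrphi ?_
  obtain ⟨C, hC⟩ := exists_norm_primeSum_classCoeff_sub_le ha haq hP hfin
  have h1 := tendsto_of_not_isOmega hΩ
  have h2 : Tendsto (fun x : ℝ ↦ C * (Real.log x / √x)) atTop (𝓝 0) := by
    have := (isLittleO_log_rpow_atTop (by norm_num : (0 : ℝ) < 1 / 2)).tendsto_div_nhds_zero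
    simpa [Real.sqrt_eq_rpow] using this.const_mul C
  have h3 := h1.add h2
  rw [add_zero] at h3
  refine squeeze_zero' (.of_forall fun x ↦ by positivity) ?_ h3
  filter_upwards [eventually_ge_atTop 1] with x hx
  have hl := Real.log_nonneg hx
  rw [norm_mul, Complex.norm_real, Real.norm_of_nonneg hl, ← mul_div_assoc, ← add_div, ← add_mul]
  gcongr
  refine (norm_le_norm_sub_add _ _).trans ((add_le_add_left (hC x) _).trans (le_of_eq ?_))
  rw [add_comm, ← Real.norm_eq_abs, ← Complex.norm_real]
  push_cast
  rfl
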